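/- Let d ≥ 2 be an integer and let μ : [0,∞) → [0,∞) be of class C^{n₀} with n₀ ≥ (d+15)/2, with μ(|p|²) > 0 for |p| < Υ := sup{|p| : μ(|p|²) ≠ 0}, satisfying the decay condition |μ(e)| ≤ C(1+e)^{-n₁} with n₁ ≥ n₀ + (d+1)/2 if Υ = ∞, or lim_{|p|→Υ} μ(|p|²)/(Υ−|p|)^{n₁} exists and is positive with n₁ ≥ min{1,(5−d)/2} if Υ < ∞, and with μ' ≤ 0 if d = 2. Define φ(u) := ∫_{ℝ^{d-1}} μ(u² + |w|²) dw, let κ₀ ≥ 0 be the survival threshold (κ₀ = 0 if Υ = ∞, and otherwise the unique positive solution of κ₀² = (1/2)∫_{|u|<Υ} φ(u)/((Υ−u)(Υ+κ₀−u)) du), and let D(λ,k) := 1 + i|k|^{-2} ∫_{ℝ^d} (μ(|p|²) − μ(|k−p|²))/(λ − 2ik·p + i|k|²) dp for k ≠ 0, Re λ > 0. Then for every δ > 0 there exists a constant c_δ > 0 such that |D(λ,k)| ≥ c_δ for all k with |k| ≥ κ₀ + δ and all λ with Re λ > 0. -/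

import Mathlib

open MeasureTheory ENNReal
open scoped RealInnerProductSpace

/-- The marginal of `μ(|p|²)` over a hyperplane in `ℝ^d`. -/
noncomputable def phiMarg (d : ℕ) (μ : ℝ → ℝ) (u : ℝ) : ℝ :=
  ∫ w : EuclideanSpace ℝ (Fin (d - 1)), μ (u ^ 2 + ‖w‖ ^ 2)

/-- The maximal particle speed `Υ = sup {|p| : μ(|p|²) ≠ 0}`. -/
noncomputable def maxSpeed (d : ℕ) (μ : ℝ → ℝ) : ℝ≥0∞ :=
  ⨆ (p : EuclideanSpace ℝ (Fin d)) (_ : μ (‖p‖ ^ 2) ≠ 0), ENNReal.ofReal ‖p‖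

/-- The Lindhard dielectric function for the Coulomb potential `ŵ(k) = |k|⁻²`:
`D(λ,k) = 1 + i|k|⁻² ∫_{ℝ^d} (μ(|p|²) − μ(|k−p|²))/(λ − 2ik·p + i|k|²) dp`. -/
noncomputable def Dlin (d : ℕ) (μ : ℝ → ℝ) (lam : ℂ)
    (k : EuclideanSpace ℝ (Fin d)) : ℂ :=
  1 + Complex.I * ((‖k‖ : ℂ) ^ 2)⁻¹ *
    ∫ p : EuclideanSpace ℝ (Fin d),
      ((μ (‖p‖ ^ 2) - μ (‖k - p‖ ^ 2) : ℝ) : ℂ) /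
        (lam - 2 * Complex.I * (⟪k, p⟫ : ℂ) + Complex.I * (‖k‖ : ℂ) ^ 2)

structure PhiOK (φ : ℝ → ℝ) (C : ℝ) : Prop where
  cont : Continuous φ
  even : ∀ u, φ (-u) = φ u
  nonneg : ∀ u, 0 ≤ φ u
  bd : ∀ u, φ u ≤ C * (1 + u ^ 2)⁻¹
  anti : ∀ u v, 0 ≤ u → u ≤ v → φ v ≤ φ u
  hol : ∀ u v, 0 ≤ u → u ≤ v → φ u - φ v ≤ C * √(v ^ 2 - u ^ 2)

noncomputable def RR (φ : ℝ → ℝ) (x η : ℝ) : ℝ :=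
  ∫ v in Set.Ioi (0 : ℝ), (φ (x + v) - φ (x - v)) * (v / (v ^ 2 + η ^ 2))

noncomputable def PP (φ : ℝ → ℝ) (x η : ℝ) : ℝ :=
  ∫ t : ℝ, φ (x + η * t) * (1 + t ^ 2)⁻¹

namespace PhiOK
variable {φ : ℝ → ℝ} {C : ℝ}

lemma C_nonneg (h : PhiOK φ C) : 0 ≤ C := by
  have h1 := h.bd 0
  have h2 := h.nonneg 0
  norm_num at h1
  linarith

lemma phi_abs (h : PhiOK φ C) (u : ℝ) : φ |u| = φ u := by
  rcases abs_choice u with h1 | h1 <;> rw [h1]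
  exact h.even u

lemma anti_abs (h : PhiOK φ C) {u v : ℝ} (huv : |u| ≤ |v|) : φ v ≤ φ u := by
  rw [← h.phi_abs u, ← h.phi_abs v]
  exact h.anti _ _ (abs_nonneg _) huv

lemma hol_abs (h : PhiOK φ C) {u v : ℝ} (huv : |u| ≤ |v|) :
    φ u - φ v ≤ C * √(v ^ 2 - u ^ 2) := by
  have := h.hol |u| |v| (abs_nonneg _) huv
  simpa [h.phi_abs] using this

lemma integrable (h : PhiOK φ C) : Integrable φ := by
  refine (integrable_inv_one_add_sq.const_mul C).mono' h.cont.aestronglyMeasurable ?_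
  filter_upwards with u
  rw [Real.norm_of_nonneg (h.nonneg u)]
  exact h.bd u

/-- key small-scale estimate, squared, one-sided -/
lemma small_aux (h : PhiOK φ C) {u w x v : ℝ} 
    (huw : |u| ≤ |w|) (hd : w ^ 2 - u ^ 2 = 4 * |x| * v) (hx : x ^ 2 ≤ 2 * u ^ 2 + 2) :
    (φ u - φ w) ^ 2 * (1 + |x|) ≤ 12 * C ^ 2 * √v := by
  have hC := h.C_nonneg
  have h0 : 0 ≤ φ u - φ w := sub_nonneg.2 (h.anti_abs huw)
  have h1 := h.hol_abs huw
  have h2 : φ u - φ w ≤ C * (3 * (1 + x ^ 2)⁻¹) := by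
    have : φ u - φ w ≤ C * (1 + u ^ 2)⁻¹ := by linarith [h.bd u, h.nonneg w]
    refine this.trans (mul_le_mul_of_nonneg_left ?_ hC)
    rw [← div_eq_mul_inv, inv_eq_one_div, div_le_div_iff₀ (by positivity) (by positivity)]
    nlinarith
  set s := √|x| with hs
  have hs0 : 0 ≤ s := Real.sqrt_nonneg _
  have hs2 : s ^ 2 = |x| := Real.sq_sqrt (abs_nonneg x)
  have hsx : x ^ 2 = s ^ 4 := by
    rw [← sq_abs, ← hs2]; ring
  have h3 : √(w ^ 2 - u ^ 2) = 2 * s * √v := by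
    rw [hd, Real.sqrt_mul (by positivity), Real.sqrt_mul (by norm_num)]
    congr 2
    rw [show (4 : ℝ) = 2 ^ 2 by norm_num, Real.sqrt_sq (by norm_num)]
  rw [h3] at h1
  have h4 : (φ u - φ w) ^ 2 ≤ (C * (2 * s * √v)) * (C * (3 * (1 + x ^ 2)⁻¹)) := by
    rw [pow_two]
    exact mul_le_mul h1 h2 h0 (by positivity)
  calc (φ u - φ w) ^ 2 * (1 + |x|)
      ≤ ((C * (2 * s * √v)) * (C * (3 * (1 + x ^ 2)⁻¹))) * (1 + |x|) := by gcongr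
    _ = 6 * C ^ 2 * √v * ((s * (1 + s ^ 2)) / (1 + s ^ 4)) := by
        rw [hsx, ← hs2]; ring
    _ ≤ 6 * C ^ 2 * √v * 2 := by
        gcongr
        rw [div_le_iff₀ (by positivity)]
        nlinarith [sq_nonneg (s - 1), sq_nonneg (s ^ 2 - 1), sq_nonneg (s^2 - s), sq_nonneg s]
    _ = 12 * C ^ 2 * √v := by ring

lemma small (h : PhiOK φ C) {x v : ℝ} (hv : 0 < v) (hv1 : v ≤ 1) :
    |φ (x + v) - φ (x - v)| * √(1 + |x|) ≤ 4 * C * v ^ (1 / 4 : ℝ) := by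
  have hC := h.C_nonneg
  have key : (φ (x + v) - φ (x - v)) ^ 2 * (1 + |x|) ≤ 12 * C ^ 2 * √v := by
    rcases le_total 0 x with hx | hx
    · have := h.small_aux (u := x - v) (w := x + v) (x := x) (v := v)
        (sq_le_sq.1 (by nlinarith)) (by rw [abs_of_nonneg hx]; ring) (by nlinarith [sq_nonneg (x - 2 * v)])
      linarith [this, sub_sq_comm (φ (x+v)) (φ (x-v)), congrArg (· * (1 + |x|)) (sub_sq_comm (φ (x+v)) (φ (x-v)))]
    · exact h.small_aux (u := x + v) (w := x - v) (x := x) (v := v)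
        (sq_le_sq.1 (by nlinarith)) (by rw [abs_of_nonpos hx]; ring) (by nlinarith [sq_nonneg (x + 2 * v)])
  have hv4 : √v = (v ^ (1 / 4 : ℝ)) ^ 2 := by
    rw [Real.sqrt_eq_rpow, ← Real.rpow_natCast, ← Real.rpow_mul hv.le]; norm_num
  apply le_of_sq_le_sq _ (by positivity)
  rw [mul_pow, sq_abs, Real.sq_sqrt (by positivity), mul_pow, ← hv4]
  nlinarith [sq_nonneg C, Real.sqrt_nonneg v, mul_nonneg (sq_nonneg C) (Real.sqrt_nonneg v)]

lemma large (h : PhiOK φ C) {x y v : ℝ} (hv : 1 < v) (hxy : |x| ≤ v + |y|) :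
    φ y / v * √(1 + |x|) ≤ C * (3 * (1 + y ^ 2)⁻¹ + v⁻¹ ^ 2) := by
  have hC := h.C_nonneg
  have hv0 : 0 < v := by linarith
  have h1 : √(1 + |x|) ≤ 1 + √v + √|y| := by
    rw [Real.sqrt_le_left (by positivity)]
    nlinarith [Real.sq_sqrt hv0.le, Real.sq_sqrt (abs_nonneg y), Real.sqrt_nonneg v, Real.sqrt_nonneg |y|,
      mul_nonneg (Real.sqrt_nonneg v) (Real.sqrt_nonneg |y|)]
  have hsv : √v ≤ v := by
    rw [Real.sqrt_le_left hv0.le]; nlinarith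
  have h2 : (1 + √v + √|y|) / v ≤ 2 + √|y| / v := by
    rw [add_div]
    have : (1 + √v) / v ≤ 2 := by rw [div_le_iff₀ hv0]; linarith
    linarith
  have h3 : (2 + √|y| / v) * (1 + y ^ 2)⁻¹ ≤ 3 * (1 + y ^ 2)⁻¹ + v⁻¹ ^ 2 := by
    set g := √|y| * (1 + y ^ 2)⁻¹ with hg
    have hg2 : g ^ 2 ≤ (1 + y ^ 2)⁻¹ := by
      rw [hg, mul_pow, Real.sq_sqrt (abs_nonneg y), inv_pow, ← div_eq_mul_inv, inv_eq_one_div,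
        div_le_div_iff₀ (by positivity) (by positivity)]
      nlinarith [sq_abs y, sq_nonneg (|y| - 1), abs_nonneg y, sq_nonneg y]
    have : (2 + √|y| / v) * (1 + y ^ 2)⁻¹ = 2 * (1 + y ^ 2)⁻¹ + g * v⁻¹ := by
      rw [hg]; ring
    rw [this]
    nlinarith [sq_nonneg (g - v⁻¹), sq_nonneg g, sq_nonneg v⁻¹]
  calc φ y / v * √(1 + |x|) ≤ (C * (1 + y ^ 2)⁻¹) / v * (1 + √v + √|y|) := by
        gcongr
        exact h.bd y
    _ = C * (((1 + √v + √|y|) / v) * (1 + y ^ 2)⁻¹) := by ring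
    _ ≤ C * ((2 + √|y| / v) * (1 + y ^ 2)⁻¹) := by gcongr
    _ ≤ _ := by gcongr

noncomputable def bn (C : ℝ) (v : ℝ) : ℝ :=
  (Set.Ioc (0 : ℝ) 1).indicator (fun v => 4 * C * v ^ (-(3 / 4) : ℝ)) v +
    (Set.Ioi (1 : ℝ)).indicator (fun v => 2 * C * v ^ (-2 : ℝ)) v

lemma bn_integrable : Integrable (bn C) := by
  unfold bn
  refine Integrable.add ?_ ?_
  · rw [integrable_indicator_iff measurableSet_Ioc]
    refine Integrable.const_mul ?_ _
    exact (intervalIntegral.intervalIntegrable_rpow' (by norm_num) : IntervalIntegrable _ volume (0 : ℝ) 1).1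
  · rw [integrable_indicator_iff measurableSet_Ioi]
    refine Integrable.const_mul ?_ _
    exact integrableOn_Ioi_rpow_of_lt (by norm_num) (by norm_num)

lemma ker_le {v : ℝ} (hv : 0 < v) (η : ℝ) : v / (v ^ 2 + η ^ 2) ≤ v⁻¹ := by
  rw [inv_eq_one_div, div_le_div_iff₀ (by positivity) hv]
  nlinarith [sq_nonneg η]

lemma ker_nonneg {v : ℝ} (hv : 0 < v) (η : ℝ) : 0 ≤ v / (v ^ 2 + η ^ 2) := by positivity

lemma ptwise (h : PhiOK φ C) (x η : ℝ) {v : ℝ} (hv : 0 < v) :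
    |(φ (x + v) - φ (x - v)) * (v / (v ^ 2 + η ^ 2))| * √(1 + |x|) ≤
      bn C v + 3 * C * ((1 + (x + v) ^ 2)⁻¹ + (1 + (x - v) ^ 2)⁻¹) := by
  have hC := h.C_nonneg
  rw [abs_mul, abs_of_nonneg (ker_nonneg hv η)]
  have h1 : |φ (x + v) - φ (x - v)| * (v / (v ^ 2 + η ^ 2)) * √(1 + |x|)
      ≤ |φ (x + v) - φ (x - v)| * v⁻¹ * √(1 + |x|) := by
    gcongr
    exact ker_le hv η
  refine h1.trans ?_
  rcases le_or_gt v 1 with hv1 | hv1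
  · have hb : bn C v = 4 * C * v ^ (-(3 / 4) : ℝ) := by
      simp [bn, hv, hv1]
    have h2 := h.small (x := x) hv hv1
    have h3 : v ^ (-(3 / 4) : ℝ) = v ^ (1 / 4 : ℝ) * v⁻¹ := by
      rw [← Real.rpow_neg_one v, ← Real.rpow_add hv]; norm_num
    have h4 : 0 ≤ 3 * C * ((1 + (x + v) ^ 2)⁻¹ + (1 + (x - v) ^ 2)⁻¹) := by positivity
    rw [hb, h3]
    have := mul_le_mul_of_nonneg_right h2 (inv_nonneg.2 hv.le)
    linarith
  · have hb : bn C v = 2 * C * v ^ (-2 : ℝ) := by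
      simp [bn, hv1]
    have h3 : v ^ (-2 : ℝ) = v⁻¹ ^ 2 := by
      rw [Real.rpow_neg hv.le, inv_pow]; norm_cast
    have l1 := h.large (x := x) (y := x + v) hv1 (by
      have := abs_sub (x + v) v; rw [add_sub_cancel_right, abs_of_pos hv] at this; linarith)
    have l2 := h.large (x := x) (y := x - v) hv1 (by
      have := abs_add_le (x - v) v; rw [sub_add_cancel, abs_of_pos hv] at this; linarith)
    have h5 : |φ (x + v) - φ (x - v)| ≤ φ (x + v) + φ (x - v) := by
      rw [abs_le]; constructor <;> linarith [h.nonneg (x + v), h.nonneg (x - v)]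
    rw [hb, h3]
    calc |φ (x + v) - φ (x - v)| * v⁻¹ * √(1 + |x|)
        ≤ (φ (x + v) + φ (x - v)) * v⁻¹ * √(1 + |x|) := by gcongr
      _ = φ (x + v) / v * √(1 + |x|) + φ (x - v) / v * √(1 + |x|) := by ring
      _ ≤ _ := by linarith

lemma ptwise' (h : PhiOK φ C) (x η : ℝ) {v : ℝ} (hv : 0 < v) :
    |(φ (x + v) - φ (x - v)) * (v / (v ^ 2 + η ^ 2))| ≤
      bn C v + 3 * C * ((1 + (x + v) ^ 2)⁻¹ + (1 + (x - v) ^ 2)⁻¹) := by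
  refine le_trans ?_ (h.ptwise x η hv)
  refine le_mul_of_one_le_right (abs_nonneg _) ?_
  rw [Real.one_le_sqrt]
  linarith [abs_nonneg x]

lemma int_inv_add (x : ℝ) : Integrable (fun v : ℝ => (1 + (x + v) ^ 2)⁻¹) :=
  integrable_inv_one_add_sq.comp_add_left x

lemma int_inv_sub (x : ℝ) : Integrable (fun v : ℝ => (1 + (x - v) ^ 2)⁻¹) :=
  integrable_inv_one_add_sq.comp_sub_left x

lemma aesm (h : PhiOK φ C) (x η : ℝ) :
    AEStronglyMeasurable (fun v : ℝ => (φ (x + v) - φ (x - v)) * (v / (v ^ 2 + η ^ 2))) := by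
  have := h.cont
  refine AEStronglyMeasurable.mul (by fun_prop) ?_
  exact (Measurable.div (by fun_prop) (by fun_prop)).aestronglyMeasurable

lemma RR_integrable (h : PhiOK φ C) (x η : ℝ) :
    IntegrableOn (fun v : ℝ => (φ (x + v) - φ (x - v)) * (v / (v ^ 2 + η ^ 2))) (Set.Ioi 0) := by
  have hi : Integrable (fun v => bn C v + 3 * C * ((1 + (x + v) ^ 2)⁻¹ + (1 + (x - v) ^ 2)⁻¹)) :=
    bn_integrable.add (((int_inv_add x).add (int_inv_sub x)).const_mul _)
  refine Integrable.mono' hi.integrableOn (h.aesm x η).restrict ?_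
  filter_upwards [ae_restrict_mem measurableSet_Ioi] with v hv
  exact h.ptwise' x η hv

lemma RR_decay (h : PhiOK φ C) : ∃ K, 0 ≤ K ∧ ∀ x η, |RR φ x η| * √(1 + |x|) ≤ K := by
  refine ⟨(∫ v in Set.Ioi (0 : ℝ), bn C v) + 3 * C * (Real.pi + Real.pi), ?_, ?_⟩
  · have hC := h.C_nonneg
    have : 0 ≤ ∫ v in Set.Ioi (0 : ℝ), bn C v := by
      refine setIntegral_nonneg measurableSet_Ioi fun v (hv : 0 < v) => ?_
      unfold bn
      refine add_nonneg (Set.indicator_nonneg (fun v hv => ?_) _) (Set.indicator_nonneg (fun v hv => ?_) _)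
      · have := hv.1; positivity
      · have : (1 : ℝ) < v := hv
        positivity
    have := Real.pi_pos
    positivity
  · intro x η
    have hC := h.C_nonneg
    have hi : Integrable (fun v => bn C v + 3 * C * ((1 + (x + v) ^ 2)⁻¹ + (1 + (x - v) ^ 2)⁻¹)) :=
      bn_integrable.add (((int_inv_add x).add (int_inv_sub x)).const_mul _)
    have h1 : |RR φ x η| * √(1 + |x|) ≤ ∫ v in Set.Ioi (0 : ℝ), (bn C v + 3 * C * ((1 + (x + v) ^ 2)⁻¹ + (1 + (x - v) ^ 2)⁻¹)) := by
      rw [← abs_of_nonneg (Real.sqrt_nonneg (1 + |x|)), ← abs_mul]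
      unfold RR
      rw [← integral_mul_const, ← Real.norm_eq_abs]
      refine norm_integral_le_of_norm_le hi.integrableOn ?_
      filter_upwards [ae_restrict_mem measurableSet_Ioi] with v hv
      rw [Real.norm_eq_abs, abs_mul, abs_of_nonneg (Real.sqrt_nonneg (1 + |x|))]
      exact h.ptwise x η hv
    refine h1.trans ?_
    have i3 : Integrable (fun v => 3 * C * ((1 + (x + v) ^ 2)⁻¹ + (1 + (x - v) ^ 2)⁻¹)) :=
      ((int_inv_add x).add (int_inv_sub x)).const_mul _
    rw [integral_add bn_integrable.integrableOn i3.integrableOn]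
    rw [integral_const_mul, integral_add (int_inv_add x).integrableOn (int_inv_sub x).integrableOn]
    have e1 : ∫ v in Set.Ioi (0 : ℝ), (1 + (x + v) ^ 2)⁻¹ ≤ Real.pi := by
      rw [← integral_univ_inv_one_add_sq, ← integral_add_left_eq_self (fun v : ℝ => (1 + v ^ 2)⁻¹) x]
      exact setIntegral_le_integral (int_inv_add x) (Filter.Eventually.of_forall fun v => by
        simp only [Pi.zero_apply]; positivity)
    have e2 : ∫ v in Set.Ioi (0 : ℝ), (1 + (x - v) ^ 2)⁻¹ ≤ Real.pi := by
      rw [← integral_univ_inv_one_add_sq, ← integral_sub_left_eq_self (fun v : ℝ => (1 + v ^ 2)⁻¹) _ x]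
      exact setIntegral_le_integral (int_inv_sub x) (Filter.Eventually.of_forall fun v => by
        simp only [Pi.zero_apply]; positivity)
    gcongr

lemma RR_decay_eta (h : PhiOK φ C) : ∃ K, 0 ≤ K ∧ ∀ x η, 0 < η → |RR φ x η| * η ≤ K := by
  refine ⟨∫ u, φ u, integral_nonneg h.nonneg, ?_⟩
  intro x η hη
  have i1 : Integrable (fun v => φ (x + v)) := h.integrable.comp_add_left x
  have i2 : Integrable (fun v => φ (x - v)) := h.integrable.comp_sub_left x
  have h1 : |RR φ x η| ≤ ∫ v in Set.Ioi (0 : ℝ), (φ (x + v) + φ (x - v)) * (1 / (2 * η)) := by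
    unfold RR
    rw [← Real.norm_eq_abs]
    refine norm_integral_le_of_norm_le ((i1.add i2).mul_const _).integrableOn ?_
    filter_upwards [ae_restrict_mem measurableSet_Ioi] with v hv
    have hv : 0 < v := hv
    rw [Real.norm_eq_abs, abs_mul, abs_of_nonneg (ker_nonneg hv η)]
    have h5 : |φ (x + v) - φ (x - v)| ≤ φ (x + v) + φ (x - v) := by
      rw [abs_le]; constructor <;> linarith [h.nonneg (x + v), h.nonneg (x - v)]
    refine mul_le_mul h5 ?_ (ker_nonneg hv η) (add_nonneg (h.nonneg _) (h.nonneg _))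
    rw [div_le_div_iff₀ (by positivity) (by positivity)]
    nlinarith [sq_nonneg (v - η)]
  rw [integral_mul_const, integral_add i1.integrableOn i2.integrableOn] at h1
  have e1 : ∫ v in Set.Ioi (0 : ℝ), φ (x + v) ≤ ∫ u, φ u := by
    rw [← integral_add_left_eq_self φ x]
    exact setIntegral_le_integral i1 (Filter.Eventually.of_forall fun v => h.nonneg _)
  have e2 : ∫ v in Set.Ioi (0 : ℝ), φ (x - v) ≤ ∫ u, φ u := by
    rw [← integral_sub_left_eq_self φ _ x]
    exact setIntegral_le_integral i2 (Filter.Eventually.of_forall fun v => h.nonneg _)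
  calc |RR φ x η| * η ≤ (((∫ v in Set.Ioi (0 : ℝ), φ (x + v)) + ∫ v in Set.Ioi (0 : ℝ), φ (x - v)) * (1 / (2 * η))) * η := by gcongr
    _ = ((∫ v in Set.Ioi (0 : ℝ), φ (x + v)) + ∫ v in Set.Ioi (0 : ℝ), φ (x - v)) / 2 := by field_simp
    _ ≤ _ := by linarith

lemma peetre {M x v : ℝ} (hx : |x| ≤ M) : (1 + (x + v) ^ 2)⁻¹ ≤ 2 * (1 + M ^ 2) * (1 + v ^ 2)⁻¹ := by
  have hM : x ^ 2 ≤ M ^ 2 := sq_le_sq' (by linarith [neg_abs_le x]) (by linarith [le_abs_self x])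
  rw [← div_eq_mul_inv, inv_eq_one_div, div_le_div_iff₀ (by positivity) (by positivity)]
  nlinarith [sq_nonneg (v + 2 * x), mul_nonneg (sq_nonneg M) (sq_nonneg (x + v)), sq_nonneg (x+v)]

lemma RR_cont (h : PhiOK φ C) : Continuous (fun q : ℝ × ℝ => RR φ q.1 q.2) := by
  have hC := h.C_nonneg
  have hc := h.cont
  rw [continuous_iff_continuousAt]
  rintro ⟨x₀, η₀⟩
  unfold RR
  refine continuousAt_of_dominated (bound := fun v => bn C v + 3 * C * (2 * (2 * (1 + (|x₀| + 1) ^ 2) * (1 + v ^ 2)⁻¹))) ?_ ?_ ?_ ?_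
  · exact Filter.Eventually.of_forall fun q => (h.aesm q.1 q.2).restrict
  · have : ∀ᶠ q : ℝ × ℝ in nhds (x₀, η₀), |q.1| < |x₀| + 1 := by
      refine ContinuousAt.eventually_lt (f := fun q : ℝ × ℝ => |q.1|) (by fun_prop) (by fun_prop) (by simp)
    filter_upwards [this] with q hq
    filter_upwards [ae_restrict_mem measurableSet_Ioi] with v hv
    refine (h.ptwise' q.1 q.2 hv).trans ?_
    have p1 := peetre (v := v) hq.le
    have p2 := peetre (x := q.1) (v := -v) hq.le
    rw [neg_sq, ← sub_eq_add_neg] at p2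
    have : (1 + (q.1 + v) ^ 2)⁻¹ + (1 + (q.1 - v) ^ 2)⁻¹ ≤ 2 * (2 * (1 + (|x₀| + 1) ^ 2) * (1 + v ^ 2)⁻¹) := by linarith
    gcongr
  · exact (bn_integrable.add (((integrable_inv_one_add_sq.const_mul _).const_mul _).const_mul _)).integrableOn
  · filter_upwards [ae_restrict_mem measurableSet_Ioi] with v hv
    have hv : 0 < v := hv
    have : v ^ 2 + η₀ ^ 2 ≠ 0 := by positivity
    refine ContinuousAt.mul (by fun_prop) ?_
    exact ContinuousAt.div (by fun_prop) (by fun_prop) this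

lemma PP_cont (h : PhiOK φ C) : Continuous (fun q : ℝ × ℝ => PP φ q.1 q.2) := by
  have hC := h.C_nonneg
  have hc := h.cont
  unfold PP
  refine continuous_of_dominated (bound := fun t => C * (1 + t ^ 2)⁻¹) ?_ ?_ ?_ ?_
  · intro q
    refine AEStronglyMeasurable.mul (by fun_prop) (integrable_inv_one_add_sq.aestronglyMeasurable)
  · intro q
    filter_upwards with t
    rw [norm_mul, Real.norm_of_nonneg (h.nonneg _), Real.norm_of_nonneg (by positivity)]
    gcongr
    refine (h.bd _).trans ?_
    refine mul_le_of_le_one_right hC ?_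
    exact inv_le_one_of_one_le₀ (by nlinarith [sq_nonneg (q.1 + q.2 * t)])
  · exact integrable_inv_one_add_sq.const_mul _
  · filter_upwards with t
    fun_prop

lemma RR_nonpos (h : PhiOK φ C) {x : ℝ} (hx : 0 ≤ x) (η : ℝ) : RR φ x η ≤ 0 := by
  refine setIntegral_nonpos measurableSet_Ioi fun v (hv : 0 < v) => ?_
  refine mul_nonpos_of_nonpos_of_nonneg ?_ (ker_nonneg hv η)
  refine sub_nonpos.2 (h.anti_abs ?_)
  exact sq_le_sq.1 (by nlinarith)

end PhiOK

namespace PhiOK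
variable {φ : ℝ → ℝ} {C : ℝ}

lemma PP_zero (x : ℝ) : PP φ x 0 = φ x * Real.pi := by
  unfold PP
  simp only [zero_mul, add_zero]
  rw [integral_const_mul, integral_univ_inv_one_add_sq]

lemma PP_eq (x : ℝ) {η : ℝ} (hη : 0 < η) :
    PP φ x η = ∫ v, φ (x + v) * (η / (v ^ 2 + η ^ 2)) := by
  have h1 := Measure.integral_comp_mul_left (fun v => φ (x + v) * (1 + (v / η) ^ 2)⁻¹) η
  unfold PP
  have h2 : ∀ t : ℝ, η * t / η = t := fun t => by field_simp
  simp only [h2] at h1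
  rw [h1, abs_of_pos (inv_pos.2 hη), ← integral_smul]
  congr 1
  ext v
  rw [smul_eq_mul]
  field_simp
  ring

lemma K_int (a : ℝ) {η : ℝ} (hη : 0 < η) (h : PhiOK φ C) (b : ℝ) :
    Integrable (fun s => φ (s + b) * (η / ((s + a) ^ 2 + η ^ 2))) := by
  have hc := h.cont
  refine (h.integrable.comp_add_right b).mul_bdd (c := η⁻¹) ?_ ?_
  · exact Continuous.aestronglyMeasurable (Continuous.div (by fun_prop) (by fun_prop) (fun s => by positivity))
  · filter_upwards with s
    rw [Real.norm_of_nonneg (by positivity), inv_eq_one_div, div_le_div_iff₀ (by positivity) hη]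
    nlinarith [sq_nonneg (s + a)]

lemma nonvan_eta (h : PhiOK φ C) {k σ η : ℝ} (hk : 0 < k) (hσ : 0 < σ) (hη : 0 < η)
    (hlt : φ (2 * σ) < φ 0) : PP φ (k / 2 + σ) η < PP φ (k / 2 - σ) η := by
  have hc := h.cont
  have e : ∀ τ : ℝ, PP φ (k / 2 + τ) η = ∫ s, φ (s + τ) * (η / ((s + -(k / 2)) ^ 2 + η ^ 2)) := by
    intro τ
    rw [PP_eq _ hη, ← integral_add_right_eq_self _ (-(k / 2))]
    congr 1; ext s; congr 2; ring
  have e1 := e (-σ)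
  rw [← sub_eq_add_neg] at e1
  set K : ℝ → ℝ := fun s => η / (s ^ 2 + η ^ 2) with hK
  have d : PP φ (k / 2 - σ) η - PP φ (k / 2 + σ) η =
      ∫ s, (φ (s + -σ) - φ (s + σ)) * K (s + -(k / 2)) := by
    rw [e1, e σ, ← integral_sub (K_int _ hη h _) (K_int _ hη h _)]
    congr 1; ext s; simp only [hK]; ring
  have i1 : Integrable (fun s => (φ (s + -σ) - φ (s + σ)) * K (s + -(k / 2))) := by
    refine ((K_int (-(k / 2)) hη h (-σ)).sub (K_int (-(k / 2)) hη h σ)).congr ?_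
    filter_upwards with s; simp only [hK, Pi.sub_apply]; ring
  have hev : ∀ s, φ (-s + -σ) - φ (-s + σ) = -(φ (s + -σ) - φ (s + σ)) := by
    intro s
    rw [← h.even (-s + -σ), ← h.even (-s + σ)]
    have : -(-s + -σ) = s + σ := by ring
    have h2 : -(-s + σ) = s + -σ := by ring
    rw [this, h2]; ring
  have hKe : ∀ s, K (-s + -(k / 2)) = K (s + k / 2) := by
    intro s; simp only [hK]; congr 2; ring
  have i2 := i1.comp_neg
  have d2 := integral_neg_eq_self (fun s => (φ (s + -σ) - φ (s + σ)) * K (s + -(k / 2))) volume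
  have d3 : 2 * (PP φ (k / 2 - σ) η - PP φ (k / 2 + σ) η) =
      ∫ s, (φ (s + -σ) - φ (s + σ)) * (K (s + -(k / 2)) - K (s + k / 2)) := by
    have db := d.trans d2.symm
    calc 2 * (PP φ (k / 2 - σ) η - PP φ (k / 2 + σ) η)
        = (PP φ (k / 2 - σ) η - PP φ (k / 2 + σ) η) + (PP φ (k / 2 - σ) η - PP φ (k / 2 + σ) η) := by ring
      _ = (∫ s, (φ (s + -σ) - φ (s + σ)) * K (s + -(k / 2))) +
          ∫ s, (φ (-s + -σ) - φ (-s + σ)) * K (-s + -(k / 2)) := by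
          nth_rewrite 1 [d]
          rw [db]
      _ = _ := by
          rw [← integral_add i1 i2]
          congr 1; ext s
          simp only [hKe, hev]; ring
  have i3 : Integrable (fun s => (φ (s + -σ) - φ (s + σ)) * (K (s + -(k / 2)) - K (s + k / 2))) := by
    refine (i1.add i2).congr ?_
    filter_upwards with s
    simp only [Pi.add_apply, hKe, hev]; ring
  have hKmono : ∀ a b : ℝ, |a| ≤ |b| → K b ≤ K a := by
    intro a b hab
    have := sq_le_sq.2 hab
    simp only [hK]
    gcongr
  have hcK : Continuous K := Continuous.div (by fun_prop) (by fun_prop) (fun s => by positivity)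
  have hpos := integral_pos_of_integrable_nonneg_nonzero (x := σ) (μ := volume)
    (f := fun s => (φ (s + -σ) - φ (s + σ)) * (K (s + -(k / 2)) - K (s + k / 2)))
    (by fun_prop) i3 ?_ ?_
  · rw [← d3] at hpos
    linarith
  · intro s
    simp only [Pi.zero_apply]
    rcases le_total 0 s with hs | hs
    · refine mul_nonneg (sub_nonneg.2 (h.anti_abs ?_)) (sub_nonneg.2 (hKmono _ _ ?_))
      · exact sq_le_sq.1 (by nlinarith)
      · exact sq_le_sq.1 (by nlinarith)
    · refine mul_nonneg_of_nonpos_of_nonpos (sub_nonpos.2 (h.anti_abs ?_)) (sub_nonpos.2 (hKmono _ _ ?_))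
      · exact sq_le_sq.1 (by nlinarith)
      · exact sq_le_sq.1 (by nlinarith)
  · refine mul_ne_zero ?_ ?_
    · rw [add_neg_cancel, ← two_mul]; linarith
    · refine (sub_pos.2 ?_).ne'
      simp only [hK]
      have : (σ + -(k / 2)) ^ 2 < (σ + k / 2) ^ 2 := by nlinarith
      gcongr

lemma RR_edge (h : PhiOK φ C) {k κ₀ y Υ : ℝ} (hκ₀ : 0 ≤ κ₀) (hk : κ₀ < k) (hΥ : 0 < Υ) (hy : Υ ≤ y)
    (hz : ∀ w, Υ ≤ |w| → φ w = 0)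
    (hint : IntegrableOn (fun u => φ u / ((Υ - u) * (Υ + κ₀ - u))) (Set.Ioo (-Υ) Υ))
    (hval : ∫ u in Set.Ioo (-Υ) Υ, φ u / ((Υ - u) * (Υ + κ₀ - u)) ≤ 2 * κ₀ ^ 2) :
    RR φ (-y) 0 + RR φ (k + y) 0 < 2 * k ^ 3 := by
  have hk0 : 0 < k := by linarith
  have gen : ∀ z, Υ ≤ z → (Integrable (fun u => φ u * (z - u)⁻¹)) ∧ RR φ z 0 = -∫ u, φ u * (z - u)⁻¹ := by
    intro z hzz
    have hi := (h.RR_integrable z 0)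
    have e : Set.EqOn (fun v : ℝ => (φ (z + v) - φ (z - v)) * (v / (v ^ 2 + 0 ^ 2)))
        (fun v => -(φ (z - v) * (z - (z - v))⁻¹)) (Set.Ioi 0) := by
      intro v hv
      have hv : 0 < v := hv
      simp only
      rw [hz (z + v) (by rw [abs_of_pos (by linarith)]; linarith)]
      have : v / (v ^ 2 + 0 ^ 2) = v⁻¹ := by field_simp; ring
      rw [this, _root_.sub_sub_cancel]; ring
    have hz0 : ∀ v : ℝ, v ∉ Set.Ioi (0:ℝ) → -(φ (z - v) * (z - (z - v))⁻¹) = 0 := by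
      intro v hv
      have hv : v ≤ 0 := by simpa using hv
      rw [hz (z - v) (by rw [abs_of_pos (by linarith)]; linarith)]; simp
    have hi2 : Integrable (fun v => -(φ (z - v) * (z - (z - v))⁻¹)) := by
      have := hi.congr_fun e measurableSet_Ioi
      rw [← integrableOn_iff_integrable_of_support_subset (s := Set.Ioi 0)]
      · exact this
      · intro v hv
        by_contra hc
        exact hv (hz0 v hc)
    constructor
    · have := (hi2.neg.comp_sub_left z)
      refine this.congr ?_
      filter_upwards with u
      simp
    · unfold RR
      rw [setIntegral_congr_fun measurableSet_Ioi e,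
        setIntegral_eq_integral_of_forall_compl_eq_zero hz0, integral_neg,
        integral_sub_left_eq_self (fun u => φ u * (z - u)⁻¹) volume z]
  have hodd : RR φ (-y) 0 = - RR φ y 0 := by
    unfold RR
    rw [← integral_neg]
    refine setIntegral_congr_fun measurableSet_Ioi fun v _ => ?_
    rw [← h.even (-y + v), ← h.even (-y - v)]
    rw [show -(-y + v) = y - v by ring, show -(-y - v) = y + v by ring]; ring
  obtain ⟨i1, r1⟩ := gen y hy
  obtain ⟨i2, r2⟩ := gen (k + y) (by linarith)
  rw [hodd, r1, r2, neg_neg, ← sub_eq_add_neg, ← integral_sub i1 i2]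
  have hs : ∫ u, (φ u * (y - u)⁻¹ - φ u * (k + y - u)⁻¹) =
      ∫ u in Set.Ioo (-Υ) Υ, (φ u * (y - u)⁻¹ - φ u * (k + y - u)⁻¹) := by
    rw [setIntegral_eq_integral_of_forall_compl_eq_zero]
    intro u hu
    rw [hz u]
    · simp
    · by_contra hc
      exact hu (abs_lt.1 (not_le.1 hc))
  rw [hs]
  have hle : ∫ u in Set.Ioo (-Υ) Υ, (φ u * (y - u)⁻¹ - φ u * (k + y - u)⁻¹) ≤
      ∫ u in Set.Ioo (-Υ) Υ, k * (φ u / ((Υ - u) * (Υ + κ₀ - u))) := by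
    refine setIntegral_mono_on (i1.sub i2).integrableOn (hint.const_mul k) measurableSet_Ioo ?_
    intro u hu
    have h1 : 0 < Υ - u := by linarith [hu.2]
    have h2 : 0 < y - u := by linarith
    have h3 : 0 < k + y - u := by linarith
    have h4 : 0 < Υ + κ₀ - u := by linarith
    have : φ u * (y - u)⁻¹ - φ u * (k + y - u)⁻¹ = k * (φ u / ((y - u) * (k + y - u))) := by
      field_simp; ring
    rw [this]
    have := h.nonneg u
    have h6 : Υ + κ₀ - u ≤ k + y - u := by linarith
    gcongr k * (_ / ?_)
    exact mul_le_mul (by linarith) h6 h4.le h2.le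
  rw [integral_const_mul] at hle
  have : k * (∫ u in Set.Ioo (-Υ) Υ, φ u / ((Υ - u) * (Υ + κ₀ - u))) ≤ k * (2 * κ₀ ^ 2) := by gcongr
  have h5 : k * (2 * κ₀ ^ 2) < 2 * k ^ 3 := by
    have : κ₀ ^ 2 < k ^ 2 := by nlinarith
    nlinarith
  linarith

def Deg (φ : ℝ → ℝ) (κ₀ u : ℝ) : Prop :=
  ∃ Υ, 0 < Υ ∧ Υ ≤ u ∧ (∀ w, Υ ≤ |w| → φ w = 0) ∧
    IntegrableOn (fun u => φ u / ((Υ - u) * (Υ + κ₀ - u))) (Set.Ioo (-Υ) Υ) ∧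
    ∫ u in Set.Ioo (-Υ) Υ, φ u / ((Υ - u) * (Υ + κ₀ - u)) ≤ 2 * κ₀ ^ 2

lemma nonvan (h : PhiOK φ C) {κ₀ : ℝ} (hκ₀ : 0 ≤ κ₀)
    (hst : ∀ u v, 0 ≤ u → u < v → φ v < φ u ∨ Deg φ κ₀ u)
    {k σ η : ℝ} (hk : κ₀ < k) (hσ : 0 ≤ σ) (hη : 0 ≤ η) :
    RR φ (k / 2 - σ) η + RR φ (k / 2 + σ) η < 2 * k ^ 3 ∨ PP φ (k / 2 - σ) η ≠ PP φ (k / 2 + σ) η := by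
  have hk0 : 0 < k := by linarith
  rcases le_or_gt 0 (k / 2 - σ) with hx | hx
  · left
    have h1 := h.RR_nonpos hx η
    have h2 := h.RR_nonpos (x := k / 2 + σ) (by linarith) η
    have : 0 < k ^ 3 := by positivity
    linarith
  have hσ' : 0 < σ := by linarith
  rcases hη.eq_or_lt with rfl | hη
  · rw [PP_zero, PP_zero]
    rcases hst (σ - k / 2) (k / 2 + σ) (by linarith) (by linarith) with h1 | ⟨Υ, h1, h2, h3, h4, h5⟩
    · right
      have e : φ (k / 2 - σ) = φ (σ - k / 2) := by rw [← h.even]; congr 1; ring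
      rw [e]
      have := Real.pi_pos
      intro hc
      have := mul_right_cancel₀ this.ne' hc
      linarith
    · left
      have := h.RR_edge hκ₀ hk h1 h2 h3 h4 h5
      rw [show -(σ - k / 2) = k / 2 - σ by ring, show k + (σ - k / 2) = k / 2 + σ by ring] at this
      exact this
  · right
    refine (h.nonvan_eta hk0 hσ' hη ?_).ne'
    rcases hst 0 (2 * σ) le_rfl (by linarith) with h1 | ⟨Υ, h1, h2, _⟩
    · exact h1
    · linarith

noncomputable def ff (φ : ℝ → ℝ) (k σ η : ℝ) : ℝ :=
  (1 - (RR φ (k / 2 - σ) η + RR φ (k / 2 + σ) η) / (2 * k ^ 3)) ^ 2 +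
    ((PP φ (k / 2 - σ) η - PP φ (k / 2 + σ) η) / (2 * k ^ 3)) ^ 2

lemma ff_neg (k σ η : ℝ) : ff φ k (-σ) η = ff φ k σ η := by
  unfold ff
  rw [sub_neg_eq_add, ← sub_eq_add_neg]
  ring

lemma ff_pos (h : PhiOK φ C) {κ₀ : ℝ} (hκ₀ : 0 ≤ κ₀)
    (hst : ∀ u v, 0 ≤ u → u < v → φ v < φ u ∨ Deg φ κ₀ u)
    {k σ η : ℝ} (hk : κ₀ < k) (hη : 0 ≤ η) : 0 < ff φ k σ η := by
  wlog hσ : 0 ≤ σ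
  · rw [← ff_neg]
    exact this h hκ₀ hst hk hη (by linarith)
  have hk0 : 0 < k := by linarith
  have hk3 : 0 < 2 * k ^ 3 := by positivity
  unfold ff
  rcases h.nonvan hκ₀ hst hk hσ hη with h1 | h1
  · have : (RR φ (k / 2 - σ) η + RR φ (k / 2 + σ) η) / (2 * k ^ 3) < 1 := by
      rw [div_lt_one hk3]; exact h1
    have : 0 < (1 - (RR φ (k / 2 - σ) η + RR φ (k / 2 + σ) η) / (2 * k ^ 3)) := by linarith
    positivity
  · have : (PP φ (k / 2 - σ) η - PP φ (k / 2 + σ) η) / (2 * k ^ 3) ≠ 0 :=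
      div_ne_zero (sub_ne_zero.2 h1) hk3.ne'
    positivity

lemma ff_quarter {k σ η ε : ℝ} (hk : 0 < k) (hε : 2 * ε ≤ k ^ 3) (h1 : |RR φ (k / 2 - σ) η| ≤ ε)
    (h2 : |RR φ (k / 2 + σ) η| ≤ ε) : 1 / 4 ≤ ff φ k σ η := by
  have hk3 : 0 < 2 * k ^ 3 := by positivity
  have : (RR φ (k / 2 - σ) η + RR φ (k / 2 + σ) η) / (2 * k ^ 3) ≤ 1 / 2 := by
    rw [div_le_iff₀ hk3]
    linarith [le_abs_self (RR φ (k / 2 - σ) η), le_abs_self (RR φ (k / 2 + σ) η)]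
  unfold ff
  nlinarith [sq_nonneg ((PP φ (k / 2 - σ) η - PP φ (k / 2 + σ) η) / (2 * k ^ 3))]

lemma lower (h : PhiOK φ C) {κ₀ δ : ℝ} (hκ₀ : 0 ≤ κ₀) (hδ : 0 < δ)
    (hst : ∀ u v, 0 ≤ u → u < v → φ v < φ u ∨ Deg φ κ₀ u) :
    ∃ c, 0 < c ∧ ∀ k σ η, κ₀ + δ ≤ k → 0 ≤ η → c ≤ ff φ k σ η := by
  obtain ⟨K, hK0, hK⟩ := h.RR_decay
  obtain ⟨L, hL0, hL⟩ := h.RR_decay_eta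
  set k₀ := κ₀ + δ with hk₀
  have hk₀p : 0 < k₀ := by linarith
  set ε := k₀ ^ 3 / 2 with hε
  have hεp : 0 < ε := by positivity
  have hKb : ∀ x η, |RR φ x η| ≤ K := by
    intro x η
    refine le_trans (le_mul_of_one_le_right (abs_nonneg _) ?_) (hK x η)
    rw [Real.one_le_sqrt]; linarith [abs_nonneg x]
  set k₁ := k₀ + 1 + 2 * K with hk₁
  set S := k₁ + (K / ε) ^ 2 + L / ε + 1 with hS
  have hk₁p : 0 < k₁ := by positivity
  have hSp : 0 < S := by positivity
  have hcomp : IsCompact (Set.Icc k₀ k₁ ×ˢ (Set.Icc (-S) S ×ˢ Set.Icc 0 S)) :=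
    isCompact_Icc.prod (isCompact_Icc.prod isCompact_Icc)
  have hne : (Set.Icc k₀ k₁ ×ˢ (Set.Icc (-S) S ×ˢ Set.Icc 0 S)).Nonempty :=
    ⟨(k₀, 0, 0), ⟨le_rfl, by linarith⟩, ⟨by linarith, by linarith⟩, ⟨le_rfl, by linarith⟩⟩
  have hcont : ContinuousOn (fun q : ℝ × ℝ × ℝ => ff φ q.1 q.2.1 q.2.2)
      (Set.Icc k₀ k₁ ×ˢ (Set.Icc (-S) S ×ˢ Set.Icc 0 S)) := by
    have r1 : Continuous (fun q : ℝ × ℝ × ℝ => RR φ (q.1 / 2 - q.2.1) q.2.2) :=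
      h.RR_cont.comp (f := fun q : ℝ × ℝ × ℝ => (q.1 / 2 - q.2.1, q.2.2)) (by fun_prop)
    have r2 : Continuous (fun q : ℝ × ℝ × ℝ => RR φ (q.1 / 2 + q.2.1) q.2.2) :=
      h.RR_cont.comp (f := fun q : ℝ × ℝ × ℝ => (q.1 / 2 + q.2.1, q.2.2)) (by fun_prop)
    have p1 : Continuous (fun q : ℝ × ℝ × ℝ => PP φ (q.1 / 2 - q.2.1) q.2.2) :=
      h.PP_cont.comp (f := fun q : ℝ × ℝ × ℝ => (q.1 / 2 - q.2.1, q.2.2)) (by fun_prop)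
    have p2 : Continuous (fun q : ℝ × ℝ × ℝ => PP φ (q.1 / 2 + q.2.1) q.2.2) :=
      h.PP_cont.comp (f := fun q : ℝ × ℝ × ℝ => (q.1 / 2 + q.2.1, q.2.2)) (by fun_prop)
    have hq : ∀ q ∈ (Set.Icc k₀ k₁ ×ˢ (Set.Icc (-S) S ×ˢ Set.Icc 0 S)), 2 * q.1 ^ 3 ≠ 0 := by
      rintro ⟨a, b, c⟩ ⟨ha, _⟩
      have : 0 < a := lt_of_lt_of_le hk₀p ha.1
      positivity
    unfold ff
    refine ContinuousOn.add (ContinuousOn.pow (ContinuousOn.sub continuousOn_const ?_) 2) (ContinuousOn.pow ?_ 2)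
    · exact ContinuousOn.div (r1.add r2).continuousOn (by fun_prop) hq
    · exact ContinuousOn.div (p1.sub p2).continuousOn (by fun_prop) hq
  obtain ⟨q₀, hq₀, hmin⟩ := hcomp.exists_isMinOn hne hcont
  have hpos : 0 < ff φ q₀.1 q₀.2.1 q₀.2.2 :=
    h.ff_pos hκ₀ hst (by have := hq₀.1.1; linarith) hq₀.2.2.1
  refine ⟨min (1 / 4) (ff φ q₀.1 q₀.2.1 q₀.2.2), lt_min (by norm_num) hpos, ?_⟩
  intro k σ η hk hη
  have hk0 : 0 < k := by linarith
  have hk3 : k₀ ^ 3 ≤ k ^ 3 := by gcongr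
  by_cases c1 : k₁ < k
  · refine (min_le_left _ _).trans (ff_quarter (ε := K) hk0 ?_ (hKb _ _) (hKb _ _))
    have : 1 ≤ k := by linarith
    have : k ≤ k ^ 3 := by nlinarith [sq_nonneg (k - 1)]
    linarith
  by_cases c2 : S < η
  · have hb : ∀ x, |RR φ x η| ≤ ε := by
      intro x
      have h1 := hL x η (by linarith)
      have h2 : L ≤ ε * η := by
        have : L / ε ≤ η := by
          have : 0 ≤ (K / ε) ^ 2 := by positivity
          linarith
        rw [div_le_iff₀ hεp] at this; linarith
      exact le_of_mul_le_mul_right (h1.trans h2) (by linarith)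
    exact (min_le_left _ _).trans (ff_quarter (ε := ε) hk0 (by linarith) (hb _) (hb _))
  by_cases c3 : S < |σ|
  · have hb : ∀ x, |σ| ≤ |x| + k / 2 → |RR φ x η| ≤ ε := by
      intro x hx
      have h1 := hK x η
      have hpos : 0 < √(1 + |x|) := Real.sqrt_pos.2 (by positivity)
      have h2 : K ≤ ε * √(1 + |x|) := by
        have : K / ε ≤ √(1 + |x|) := by
          apply Real.le_sqrt_of_sq_le
          have : 0 ≤ L / ε := by positivity
          linarith
        rw [div_le_iff₀ hεp] at this; linarith
      exact le_of_mul_le_mul_right (h1.trans h2) hpos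
    refine (min_le_left _ _).trans (ff_quarter (ε := ε) hk0 (by linarith) (hb _ ?_) (hb _ ?_))
    · have := abs_sub (k / 2) (k / 2 - σ)
      rw [_root_.sub_sub_cancel, abs_of_pos (by linarith : 0 < k / 2)] at this
      linarith
    · have := abs_sub (k / 2 + σ) (k / 2)
      rw [add_sub_cancel_left, abs_of_pos (by linarith : 0 < k / 2)] at this
      linarith
  · push Not at c1 c2 c3
    refine (min_le_right _ _).trans ?_
    exact hmin (a := (k, σ, η)) ⟨⟨hk, c1⟩, abs_le.1 c3, hη, c2⟩

end PhiOK

namespace PhiOK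
variable {φ : ℝ → ℝ} {C : ℝ}

lemma cauchy (h : PhiOK φ C) (x : ℝ) {η : ℝ} (hη : 0 < η) :
    ∫ u : ℝ, (φ u : ℂ) * ((u : ℂ) - x - Complex.I * η)⁻¹ = (RR φ x η : ℂ) + (PP φ x η : ℂ) * Complex.I := by
  have hc := h.cont
  have ix : Integrable (fun v => φ (x + v)) := h.integrable.comp_add_left x
  have ia : Integrable (fun v => φ (x + v) * (v / (v ^ 2 + η ^ 2))) := by
    refine ix.mul_bdd (c := 1 / (2 * η)) ?_ ?_
    · exact Continuous.aestronglyMeasurable (Continuous.div (by fun_prop) (by fun_prop) (fun s => by positivity))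
    · filter_upwards with v
      rw [norm_div, Real.norm_of_nonneg (by positivity : 0 ≤ v ^ 2 + η ^ 2), div_le_div_iff₀ (by positivity) (by positivity), Real.norm_eq_abs]
      nlinarith [sq_nonneg (|v| - η), sq_abs v]
  have ib : Integrable (fun v => φ (x + v) * (η / (v ^ 2 + η ^ 2))) := by
    have := K_int 0 hη h x
    simpa [add_comm] using this
  have ha : ∫ v, φ (x + v) * (v / (v ^ 2 + η ^ 2)) = RR φ x η := by
    rw [← intervalIntegral.integral_Iic_add_Ioi (b := 0) ia.integrableOn ia.integrableOn]
    have := integral_comp_neg_Ioi 0 (fun v => φ (x + v) * (v / (v ^ 2 + η ^ 2)))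
    rw [neg_zero] at this
    have i2 := ia.comp_neg
    rw [← this, ← integral_add i2.integrableOn ia.integrableOn]
    unfold RR
    congr 1; ext v
    rw [← sub_eq_add_neg]; ring
  have hb : ∫ v, φ (x + v) * (η / (v ^ 2 + η ^ 2)) = PP φ x η := (PP_eq x hη).symm
  rw [← integral_add_left_eq_self _ x, ← ha, ← hb, ← integral_complex_ofReal, ← integral_complex_ofReal,
    ← integral_mul_const, ← integral_add ia.ofReal (ib.ofReal.mul_const _)]
  congr 1; ext v
  have h1 : (v : ℂ) ^ 2 + (η : ℂ) ^ 2 ≠ 0 := by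
    have : v ^ 2 + η ^ 2 ≠ 0 := by positivity
    exact_mod_cast this
  have h2 : ((x + v : ℝ) : ℂ) - x - Complex.I * η ≠ 0 := by
    intro hc
    have := congrArg Complex.im hc
    simp at this
    exact hη.ne' this
  push_cast at h2 ⊢
  have h3 : ((x : ℂ) + v - x - Complex.I * η) = v - Complex.I * η := by ring
  rw [h3] at h2 ⊢
  have h4 : ((v : ℂ) - Complex.I * η) * (v + Complex.I * η) = v ^ 2 + η ^ 2 := by
    ring_nf; rw [Complex.I_sq]; ring
  have h5 : ((v : ℂ) - Complex.I * η)⁻¹ = (v + Complex.I * η) / (v ^ 2 + η ^ 2) := by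
    rw [← h4] at h1 ⊢
    field_simp
    rw [div_self (right_ne_zero_of_mul h1)]
  rw [h5]; ring

lemma cauchy' (h : PhiOK φ C) (x : ℝ) {η : ℝ} (hη : 0 < η) :
    ∫ u : ℝ, (φ u : ℂ) * ((u : ℂ) - x + Complex.I * η)⁻¹ = (RR φ x η : ℂ) - (PP φ x η : ℂ) * Complex.I := by
  have := congrArg (starRingEnd ℂ) (h.cauchy x hη)
  rw [← integral_conj] at this
  simpa [← sub_eq_add_neg] using this

end PhiOK

lemma marg_split (n : ℕ) (F : ℝ × EuclideanSpace ℝ (Fin n) → ℂ)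
    (hF : Integrable (fun p : EuclideanSpace ℝ (Fin (n + 1)) => F (p 0, WithLp.toLp 2 (fun i => p i.succ)))) :
    ∫ p : EuclideanSpace ℝ (Fin (n + 1)), F (p 0, WithLp.toLp 2 (fun i => p i.succ)) =
      ∫ u : ℝ, ∫ w : EuclideanSpace ℝ (Fin n), F (u, w) := by
  have m1 := PiLp.volume_preserving_ofLp (Fin (n + 1))
  have m2 := volume_preserving_piFinSuccAbove (fun _ : Fin (n + 1) => ℝ) 0
  have m3 := (MeasurePreserving.id (volume : Measure ℝ)).prod (PiLp.volume_preserving_toLp (Fin n))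
  let e : EuclideanSpace ℝ (Fin (n + 1)) ≃ᵐ ℝ × EuclideanSpace ℝ (Fin n) :=
    ((MeasurableEquiv.toLp 2 (Fin (n + 1) → ℝ)).symm.trans
      (MeasurableEquiv.piFinSuccAbove (fun _ : Fin (n + 1) => ℝ) 0)).trans
      ((MeasurableEquiv.refl ℝ).prodCongr (MeasurableEquiv.toLp 2 (Fin n → ℝ)))
  have he : MeasurePreserving e volume volume := m3.comp (m2.comp m1)
  have hv : ∀ p, e p = (p 0, WithLp.toLp 2 (fun i => p i.succ)) := by
    intro p
    rfl
  have h1 : ∫ p, F (e p) = ∫ q, F q := he.integral_comp' F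
  simp only [← hv] at hF ⊢
  rw [h1]
  have hF2 : Integrable F := (he.integrable_comp_emb e.measurableEmbedding).1 hF
  exact integral_prod F hF2

lemma marg (n : ℕ) (μ : ℝ → ℝ)
    (hi : Integrable (fun p : EuclideanSpace ℝ (Fin (n + 1)) => μ (‖p‖ ^ 2)))
    (k : EuclideanSpace ℝ (Fin (n + 1))) (g : ℝ → ℂ) (hg : Continuous g) (B : ℝ) (hB : ∀ t, ‖g t‖ ≤ B) :
    Integrable (fun p : EuclideanSpace ℝ (Fin (n + 1)) => (μ (‖p‖ ^ 2) : ℂ) * g ⟪k, p⟫) ∧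
    ∫ p : EuclideanSpace ℝ (Fin (n + 1)), (μ (‖p‖ ^ 2) : ℂ) * g ⟪k, p⟫ =
      ∫ u : ℝ, (phiMarg (n + 1) μ u : ℂ) * g (‖k‖ * u) := by
  have hint : ∀ k : EuclideanSpace ℝ (Fin (n + 1)),
      Integrable (fun p : EuclideanSpace ℝ (Fin (n + 1)) => (μ (‖p‖ ^ 2) : ℂ) * g ⟪k, p⟫) := by
    intro k
    refine hi.ofReal.mul_bdd (c := B) ?_ (Filter.Eventually.of_forall fun p => hB _)
    exact Continuous.aestronglyMeasurable (by fun_prop)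
  refine ⟨hint k, ?_⟩
  set w : EuclideanSpace ℝ (Fin (n + 1)) := ‖k‖ • EuclideanSpace.single 0 (1 : ℝ) with hw
  have hn : ‖k‖ = ‖w‖ := by
    rw [hw, norm_smul]; simp
  set ρ := (Submodule.span ℝ {k - w})ᗮ.reflection with hρ
  have hρk : ρ k = w := Submodule.reflection_sub hn
  have hin : ∀ p, ⟪k, ρ p⟫ = ‖k‖ * p 0 := by
    intro p
    have h1 : ⟪ρ k, ρ (ρ p)⟫ = ⟪k, ρ p⟫ := ρ.inner_map_map k (ρ p)
    rw [Submodule.reflection_reflection, hρk] at h1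
    rw [← h1, hw, real_inner_smul_left, EuclideanSpace.inner_single_left]
    simp
  have h1 : ∫ p, (μ (‖ρ p‖ ^ 2) : ℂ) * g ⟪k, ρ p⟫ = ∫ p, (μ (‖p‖ ^ 2) : ℂ) * g ⟪k, p⟫ :=
    ρ.measurePreserving.integral_comp ρ.toHomeomorph.measurableEmbedding
      (fun p : EuclideanSpace ℝ (Fin (n + 1)) => (μ (‖p‖ ^ 2) : ℂ) * g ⟪k, p⟫)
  have h2 : Integrable fun p => (μ (‖ρ p‖ ^ 2) : ℂ) * g ⟪k, ρ p⟫ :=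
    (ρ.measurePreserving.integrable_comp_emb ρ.toHomeomorph.measurableEmbedding).2 (hint k)
  rw [← h1]
  have hnorm : ∀ p : EuclideanSpace ℝ (Fin (n + 1)),
      ‖p‖ ^ 2 = (p 0) ^ 2 + ‖(WithLp.toLp 2 (fun i : Fin n => p i.succ) : EuclideanSpace ℝ (Fin n))‖ ^ 2 := by
    intro p
    rw [EuclideanSpace.real_norm_sq_eq, EuclideanSpace.real_norm_sq_eq, Fin.sum_univ_succ]
  have hfun : (fun p => (μ (‖ρ p‖ ^ 2) : ℂ) * g ⟪k, ρ p⟫) =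
      fun p => (fun q : ℝ × EuclideanSpace ℝ (Fin n) => (μ (q.1 ^ 2 + ‖q.2‖ ^ 2) : ℂ) * g (‖k‖ * q.1))
        (p 0, WithLp.toLp 2 (fun i => p i.succ)) := by
    ext p
    simp only [hin, LinearIsometryEquiv.norm_map]
    rw [hnorm p]
  rw [hfun] at h2 ⊢
  refine (marg_split n (fun q : ℝ × EuclideanSpace ℝ (Fin n) => (μ (q.1 ^ 2 + ‖q.2‖ ^ 2) : ℂ) * g (‖k‖ * q.1)) h2).trans ?_
  congr 1; ext u
  simp only
  rw [integral_mul_const, integral_complex_ofReal]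
  rfl

lemma Dlin_eq (n : ℕ) (μ : ℝ → ℝ) {C : ℝ} (h : PhiOK (phiMarg (n + 1) μ) C)
    (hi : Integrable (fun p : EuclideanSpace ℝ (Fin (n + 1)) => μ (‖p‖ ^ 2)))
    (k : EuclideanSpace ℝ (Fin (n + 1))) (hk : 0 < ‖k‖) (lam : ℂ) (hlam : 0 < lam.re) :
    ‖Dlin (n + 1) μ lam k‖ ^ 2 =
      PhiOK.ff (phiMarg (n + 1) μ) ‖k‖ (lam.im / (2 * ‖k‖)) (lam.re / (2 * ‖k‖)) := by
  set φ := phiMarg (n + 1) μ with hφ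
  set κ := ‖k‖ with hκ
  set σ := lam.im / (2 * κ) with hσ
  set η := lam.re / (2 * κ) with hη
  have hη0 : 0 < η := by positivity
  have hκC : (κ : ℂ) ≠ 0 := by exact_mod_cast hk.ne'
  have hlamE : lam = 2 * κ * (η + σ * Complex.I) := by
    have a1 : 2 * κ * η = lam.re := by rw [hη]; field_simp
    have a2 : 2 * κ * σ = lam.im := by rw [hσ]; field_simp
    clear_value η σ
    apply Complex.ext
    · simp; linarith
    · simp; linarith
  set g : ℝ → ℂ := fun t => (lam - 2 * Complex.I * t + Complex.I * (κ : ℂ) ^ 2)⁻¹ with hg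
  have hre : ∀ t : ℝ, (lam - 2 * Complex.I * t + Complex.I * (κ : ℂ) ^ 2).re = lam.re := by
    intro t
    simp [← Complex.ofReal_pow]
  have hne : ∀ t : ℝ, (lam - 2 * Complex.I * t + Complex.I * (κ : ℂ) ^ 2) ≠ 0 := by
    intro t hc
    have := hre t
    rw [hc] at this
    simp at this
    linarith
  have hgc : Continuous g := Continuous.inv₀ (by fun_prop) hne
  have hgB : ∀ t, ‖g t‖ ≤ lam.re⁻¹ := by
    intro t
    rw [hg, norm_inv]
    apply inv_anti₀ hlam
    rw [← hre t]
    exact Complex.re_le_norm _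
  obtain ⟨i1, e1⟩ := marg n μ hi k g hgc _ hgB
  obtain ⟨i2, e2⟩ := marg n μ hi k (fun t => g (κ ^ 2 - t)) (by fun_prop) _ (fun t => hgB _)
  have hk2 : ∀ p, κ ^ 2 - ⟪k, k - p⟫ = ⟪k, p⟫ := by
    intro p
    rw [inner_sub_right, real_inner_self_eq_norm_sq]; ring
  have i3 := i2.comp_sub_left k
  have e3 := integral_sub_left_eq_self (fun p : EuclideanSpace ℝ (Fin (n + 1)) => (μ (‖p‖ ^ 2) : ℂ) * g (κ ^ 2 - ⟪k, p⟫)) volume k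
  simp only [hk2] at i3 e3
  have key : ∫ p : EuclideanSpace ℝ (Fin (n + 1)),
      ((μ (‖p‖ ^ 2) - μ (‖k - p‖ ^ 2) : ℝ) : ℂ) /
        (lam - 2 * Complex.I * (⟪k, p⟫ : ℂ) + Complex.I * (κ : ℂ) ^ 2) =
      (∫ u : ℝ, (φ u : ℂ) * g (κ * u)) - ∫ u : ℝ, (φ u : ℂ) * g (κ ^ 2 - κ * u) := by
    rw [← e1, ← e2, ← e3, ← integral_sub i1 i3]
    congr 1; ext p
    simp only [hg]
    push_cast
    rw [div_eq_mul_inv]; ring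
  have c1 := h.cauchy (κ / 2 - σ) hη0
  have c2 := h.cauchy' (κ / 2 + σ) hη0
  have f1 : ∫ u : ℝ, (φ u : ℂ) * g (κ * u) = (Complex.I / (2 * κ)) *
      ∫ u : ℝ, (φ u : ℂ) * ((u : ℂ) - ((κ / 2 + σ : ℝ) : ℂ) + Complex.I * η)⁻¹ := by
    rw [← integral_const_mul]
    congr 1; ext u
    have : (lam - 2 * Complex.I * ((κ * u : ℝ) : ℂ) + Complex.I * (κ : ℂ) ^ 2) =
        (2 * κ / Complex.I) * ((u : ℂ) - ((κ / 2 + σ : ℝ) : ℂ) + Complex.I * η) := by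
      rw [hlamE, Complex.div_I]; push_cast; ring_nf; rw [Complex.I_sq]; ring
    simp only [hg]
    rw [this, mul_inv, inv_div]; ring
  have f2 : ∫ u : ℝ, (φ u : ℂ) * g (κ ^ 2 - κ * u) = -(Complex.I / (2 * κ)) *
      ∫ u : ℝ, (φ u : ℂ) * ((u : ℂ) - ((κ / 2 - σ : ℝ) : ℂ) - Complex.I * η)⁻¹ := by
    rw [← integral_const_mul]
    congr 1; ext u
    have : (lam - 2 * Complex.I * ((κ ^ 2 - κ * u : ℝ) : ℂ) + Complex.I * (κ : ℂ) ^ 2) =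
        (-(2 * κ / Complex.I)) * ((u : ℂ) - ((κ / 2 - σ : ℝ) : ℂ) - Complex.I * η) := by
      rw [hlamE, Complex.div_I]; push_cast; ring_nf; rw [Complex.I_sq]; ring
    simp only [hg]
    rw [this, mul_inv, inv_neg, inv_div]; ring
  have fin : Dlin (n + 1) μ lam k = ((1 - (RR φ (κ / 2 - σ) η + RR φ (κ / 2 + σ) η) / (2 * κ ^ 3) : ℝ) : ℂ) +
      ((-((PP φ (κ / 2 - σ) η - PP φ (κ / 2 + σ) η) / (2 * κ ^ 3)) : ℝ) : ℂ) * Complex.I := by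
    unfold Dlin
    rw [← hκ, key, f1, f2, c1, c2]
    push_cast
    field_simp
    ring_nf
    simp only [Complex.I_sq, show Complex.I ^ 3 = -Complex.I from Complex.I_pow_three]
    ring
  rw [fin, ← Complex.normSq_eq_norm_sq, Complex.normSq_add_mul_I]
  unfold PhiOK.ff
  ring

structure MuOK (N : ℕ) (μ : ℝ → ℝ) (C : ℝ) : Prop where
  cont : Continuous μ
  nonneg : ∀ e, 0 ≤ e → 0 ≤ μ e
  C0 : 0 ≤ C
  dec : ∀ e, 0 ≤ e → μ e ≤ C * ((1 + e) ^ (N + 2))⁻¹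

noncomputable def GG (μ : ℝ → ℝ) (m : ℕ) (u : ℝ) : ℝ := ∫ r in Set.Ioi (0 : ℝ), r ^ m * μ (u ^ 2 + r ^ 2)

noncomputable def JJ : ℝ := ∫ r in Set.Ioi (0 : ℝ), (1 + r ^ 2)⁻¹

lemma JJ_nonneg : 0 ≤ JJ := integral_nonneg fun r => by positivity

lemma JJ_int : IntegrableOn (fun r : ℝ => (1 + r ^ 2)⁻¹) (Set.Ioi 0) := integrable_inv_one_add_sq.integrableOn

namespace MuOK
variable {N : ℕ} {μ : ℝ → ℝ} {C : ℝ}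

lemma bd (h : MuOK N μ C) {m : ℕ} (hm : m ≤ N) (u : ℝ) {r : ℝ} (hr : 0 < r) :
    r ^ m * μ (u ^ 2 + r ^ 2) ≤ C * (1 + u ^ 2)⁻¹ * (1 + r ^ 2)⁻¹ := by
  have h1 := h.dec (u ^ 2 + r ^ 2) (by positivity)
  have hC := h.C0
  set X := 1 + (u ^ 2 + r ^ 2) with hX
  have hX1 : 1 ≤ X := by rw [hX]; nlinarith [sq_nonneg u, sq_nonneg r]
  have h2 : r ^ m * ((1 + u ^ 2) * (1 + r ^ 2)) ≤ X ^ (N + 2) := by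
    have a1 : r ^ m ≤ X ^ N := by
      refine (pow_le_pow_left₀ hr.le (?_ : r ≤ X) m).trans (pow_le_pow_right₀ hX1 hm)
      rw [hX]; nlinarith [sq_nonneg u, sq_nonneg (r - 1)]
    have a2 : (1 + u ^ 2) * (1 + r ^ 2) ≤ X ^ 2 := by
      rw [hX]; nlinarith [sq_nonneg u, sq_nonneg r, mul_nonneg (sq_nonneg u) (sq_nonneg r)]
    rw [pow_add]
    exact mul_le_mul a1 a2 (by positivity) (by positivity)
  have h3 : r ^ m * (X ^ (N + 2))⁻¹ ≤ (1 + u ^ 2)⁻¹ * (1 + r ^ 2)⁻¹ := by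
    rw [← mul_inv, ← div_eq_mul_inv, div_le_iff₀ (by positivity), inv_mul_eq_div, le_div_iff₀ (by positivity)]
    exact h2
  calc r ^ m * μ (u ^ 2 + r ^ 2) ≤ r ^ m * (C * (X ^ (N + 2))⁻¹) := by gcongr
    _ = C * (r ^ m * (X ^ (N + 2))⁻¹) := by ring
    _ ≤ C * ((1 + u ^ 2)⁻¹ * (1 + r ^ 2)⁻¹) := by gcongr
    _ = _ := by ring

lemma bd' (h : MuOK N μ C) {m : ℕ} (hm : m ≤ N) (u : ℝ) {r : ℝ} (hr : 0 < r) :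
    r ^ m * μ (u ^ 2 + r ^ 2) ≤ C * (1 + r ^ 2)⁻¹ := by
  refine (h.bd hm u hr).trans ?_
  have : (1 + u ^ 2)⁻¹ ≤ 1 := inv_le_one_of_one_le₀ (by nlinarith [sq_nonneg u])
  have hC := h.C0
  calc C * (1 + u ^ 2)⁻¹ * (1 + r ^ 2)⁻¹ ≤ C * 1 * (1 + r ^ 2)⁻¹ := by gcongr
    _ = _ := by ring

lemma nn (h : MuOK N μ C) (m : ℕ) (u : ℝ) {r : ℝ} (hr : 0 < r) : 0 ≤ r ^ m * μ (u ^ 2 + r ^ 2) :=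
  mul_nonneg (by positivity) (h.nonneg _ (by positivity))

lemma int (h : MuOK N μ C) {m : ℕ} (hm : m ≤ N) (u : ℝ) :
    IntegrableOn (fun r => r ^ m * μ (u ^ 2 + r ^ 2)) (Set.Ioi 0) := by
  have hc := h.cont
  refine Integrable.mono' (JJ_int.const_mul C) (Continuous.aestronglyMeasurable (by fun_prop)) ?_
  filter_upwards [ae_restrict_mem measurableSet_Ioi] with r hr
  rw [Real.norm_of_nonneg (h.nn m u hr)]
  exact h.bd' hm u hr

lemma GG_nonneg (h : MuOK N μ C) (m : ℕ) (u : ℝ) : 0 ≤ GG μ m u :=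
  setIntegral_nonneg measurableSet_Ioi fun _ hr => h.nn m u hr

lemma GG_bd (h : MuOK N μ C) {m : ℕ} (hm : m ≤ N) (u : ℝ) : GG μ m u ≤ C * JJ * (1 + u ^ 2)⁻¹ := by
  have : ∫ r in Set.Ioi (0 : ℝ), C * (1 + u ^ 2)⁻¹ * (1 + r ^ 2)⁻¹ = C * JJ * (1 + u ^ 2)⁻¹ := by
    rw [integral_const_mul, ← JJ]; ring
  rw [← this]
  exact setIntegral_mono_on (h.int hm u) (JJ_int.const_mul _) measurableSet_Ioi fun r hr => h.bd hm u hr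

lemma GG_bd' (h : MuOK N μ C) {m : ℕ} (hm : m ≤ N) (u : ℝ) : GG μ m u ≤ C * JJ := by
  rw [JJ, ← integral_const_mul]
  exact setIntegral_mono_on (h.int hm u) (JJ_int.const_mul _) measurableSet_Ioi fun r hr => h.bd' hm u hr

lemma GG_cont (h : MuOK N μ C) {m : ℕ} (hm : m ≤ N) : Continuous (GG μ m) := by
  have hc := h.cont
  refine continuous_of_dominated (bound := fun r => C * (1 + r ^ 2)⁻¹) ?_ ?_ (JJ_int.const_mul C) ?_
  · intro u
    exact Continuous.aestronglyMeasurable (by fun_prop)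
  · intro u
    filter_upwards [ae_restrict_mem measurableSet_Ioi] with r hr
    rw [Real.norm_of_nonneg (h.nn m u hr)]
    exact h.bd' hm u hr
  · filter_upwards with r
    fun_prop

end MuOK

lemma pow_sub_le {r b : ℝ} (hb : 0 ≤ b) (hbr : b ≤ r) (j : ℕ) :
    r ^ (j + 1) - b ^ (j + 1) ≤ (j + 1) * (r - b) * r ^ j := by
  induction j with
  | zero => simp
  | succ j ih =>
    have h1 : b ^ (j + 1) ≤ r ^ (j + 1) := pow_le_pow_left₀ hb hbr _
    have h2 : r ^ (j + 1 + 1) - b ^ (j + 1 + 1) = r * (r ^ (j + 1) - b ^ (j + 1)) + b ^ (j + 1) * (r - b) := by ring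
    rw [h2]
    have h3 := mul_le_mul_of_nonneg_left ih (hb.trans hbr)
    have h4 := mul_le_mul_of_nonneg_right h1 (sub_nonneg.2 hbr)
    push_cast
    calc _ ≤ r * ((j + 1) * (r - b) * r ^ j) + r ^ (j + 1) * (r - b) := add_le_add h3 h4
      _ = _ := by ring

lemma cov (a : ℝ) (g : ℝ → ℝ) : ∫ e in Set.Ioi a, g e = ∫ r in Set.Ioi (0 : ℝ), 2 * r * g (a + r ^ 2) := by
  have him : (fun r : ℝ => a + r ^ 2) '' Set.Ioi 0 = Set.Ioi a := by
    ext e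
    simp only [Set.mem_image, Set.mem_Ioi]
    constructor
    · rintro ⟨r, hr, rfl⟩
      have : 0 < r ^ 2 := by positivity
      linarith
    · intro he
      refine ⟨√(e - a), Real.sqrt_pos.2 (by linarith), ?_⟩
      rw [Real.sq_sqrt (by linarith)]; ring
  have hinj : Set.InjOn (fun r : ℝ => a + r ^ 2) (Set.Ioi 0) := by
    intro x hx y hy hxy
    simp only [Set.mem_Ioi] at hx hy
    have : x ^ 2 = y ^ 2 := by simpa using hxy
    exact (pow_left_inj₀ hx.le hy.le two_ne_zero).1 this
  have hd : ∀ x ∈ Set.Ioi (0 : ℝ), HasDerivWithinAt (fun r : ℝ => a + r ^ 2) (2 * x) (Set.Ioi 0) x := by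
    intro x _
    have := ((hasDerivAt_pow 2 x).const_add a).hasDerivWithinAt (s := Set.Ioi 0)
    simpa using this
  have := integral_image_eq_integral_abs_deriv_smul measurableSet_Ioi hd hinj g
  rw [him] at this
  rw [this]
  refine setIntegral_congr_fun measurableSet_Ioi fun r hr => ?_
  simp only [Set.mem_Ioi] at hr
  simp [abs_of_pos hr]

noncomputable def ww (j : ℕ) (t r : ℝ) : ℝ := if t < r ^ 2 then √(r ^ 2 - t) ^ j else 0

lemma ww_le (j : ℕ) {t r : ℝ} (ht : 0 ≤ t) (hr : 0 < r) : ww j t r ≤ r ^ j := by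
  unfold ww
  split_ifs with hh
  · refine pow_le_pow_left₀ (Real.sqrt_nonneg _) ?_ j
    rw [Real.sqrt_le_left hr.le]; linarith
  · positivity

lemma ww_nonneg (j : ℕ) (t r : ℝ) : 0 ≤ ww j t r := by
  unfold ww
  split_ifs <;> positivity

lemma ww_low (j : ℕ) {t r : ℝ} (ht : 0 ≤ t) (hr : 0 < r) :
    r ^ (j + 1) - r * ww j t r ≤ (j + 1) * √t * r ^ j := by
  unfold ww
  split_ifs with hh
  · set b := √(r ^ 2 - t) with hb
    have hb0 : 0 ≤ b := Real.sqrt_nonneg _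
    have hb2 : b ^ 2 = r ^ 2 - t := Real.sq_sqrt (by linarith)
    have hs2 : √t ^ 2 = t := Real.sq_sqrt ht
    have hs0 := Real.sqrt_nonneg t
    have hbr : b ≤ r := by nlinarith
    have hrs : r - b ≤ √t := by
      have : r ≤ b + √t := by
        apply le_of_sq_le_sq _ (by positivity)
        nlinarith [mul_nonneg hb0 hs0]
      linarith
    have := pow_sub_le hb0 hbr j
    have h2 : b ^ (j + 1) ≤ r * b ^ j := by
      rw [pow_succ']; gcongr
    calc r ^ (j + 1) - r * b ^ j ≤ (j + 1) * (r - b) * r ^ j := by linarith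
      _ ≤ _ := by gcongr
  · have : r ≤ √t := Real.le_sqrt_of_sq_le (not_lt.1 hh)
    rw [mul_zero, sub_zero, pow_succ']
    gcongr
    nlinarith [Real.sqrt_nonneg t, mul_nonneg (Nat.cast_nonneg (α := ℝ) j) (Real.sqrt_nonneg t)]

lemma GG_shift (μ : ℝ → ℝ) (j : ℕ) {u v : ℝ} (hu : 0 ≤ u) (huv : u ≤ v) :
    GG μ (j + 1) v = ∫ r in Set.Ioi (0 : ℝ), r * ww j (v ^ 2 - u ^ 2) r * μ (u ^ 2 + r ^ 2) := by
  have h1 := cov (v ^ 2) (fun e => √(e - v ^ 2) ^ j * μ e)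
  have h2 := cov (u ^ 2) ((Set.Ioi (v ^ 2)).indicator (fun e => √(e - v ^ 2) ^ j * μ e))
  have hsq : u ^ 2 ≤ v ^ 2 := by gcongr
  rw [setIntegral_indicator measurableSet_Ioi, Set.inter_eq_self_of_subset_right (Set.Ioi_subset_Ioi hsq), h1] at h2
  have e1 : ∫ r in Set.Ioi (0 : ℝ), 2 * r * (√(v ^ 2 + r ^ 2 - v ^ 2) ^ j * μ (v ^ 2 + r ^ 2)) = 2 * GG μ (j + 1) v := by
    rw [GG, ← integral_const_mul]
    refine setIntegral_congr_fun measurableSet_Ioi fun r hr => ?_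
    simp only [Set.mem_Ioi] at hr
    simp only [add_sub_cancel_left, Real.sqrt_sq hr.le]
    ring
  have e2 : ∫ r in Set.Ioi (0 : ℝ), 2 * r * (Set.Ioi (v ^ 2)).indicator (fun e => √(e - v ^ 2) ^ j * μ e) (u ^ 2 + r ^ 2)
      = 2 * ∫ r in Set.Ioi (0 : ℝ), r * ww j (v ^ 2 - u ^ 2) r * μ (u ^ 2 + r ^ 2) := by
    rw [← integral_const_mul]
    refine setIntegral_congr_fun measurableSet_Ioi fun r hr => ?_
    simp only [Set.indicator, Set.mem_Ioi, ww]
    by_cases hh : v ^ 2 < u ^ 2 + r ^ 2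
    · rw [if_pos hh, if_pos (by linarith), show r ^ 2 - (v ^ 2 - u ^ 2) = u ^ 2 + r ^ 2 - v ^ 2 by ring]; ring
    · rw [if_neg hh, if_neg (by linarith)]; ring
  rw [e1, e2] at h2
  linarith

lemma pos_of {f : ℝ → ℝ} (hf : IntegrableOn f (Set.Ioi 0)) (h0 : ∀ r, 0 < r → 0 ≤ f r) {a b : ℝ} (ha : 0 ≤ a)
    (hab : a < b) (hp : ∀ r, a < r → r < b → 0 < f r) : 0 < ∫ r in Set.Ioi (0 : ℝ), f r := by
  rw [setIntegral_pos_iff_support_of_nonneg_ae]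
  · refine lt_of_lt_of_le ?_ (measure_mono (?_ : Set.Ioo a b ⊆ _))
    · rw [Real.volume_Ioo]
      simpa using hab
    · rintro r ⟨h1, h2⟩
      exact ⟨(hp r h1 h2).ne', lt_of_le_of_lt ha h1⟩
  · filter_upwards [ae_restrict_mem measurableSet_Ioi] with r hr
    exact h0 r hr
  · exact hf

namespace MuOK
variable {N : ℕ} {μ : ℝ → ℝ} {C : ℝ}

lemma wint (h : MuOK N μ C) {j : ℕ} (hm : j + 1 ≤ N) (u : ℝ) {t : ℝ} (ht : 0 ≤ t) :
    IntegrableOn (fun r => r * ww j t r * μ (u ^ 2 + r ^ 2)) (Set.Ioi 0) := by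
  have hc := h.cont
  refine Integrable.mono' (h.int hm u) ?_ ?_
  · have : Measurable (ww j t) := by
      unfold ww
      exact Measurable.ite (measurableSet_lt measurable_const (by fun_prop)) (by fun_prop) measurable_const
    have h2 : Measurable (fun r => μ (u ^ 2 + r ^ 2)) := Continuous.measurable (by fun_prop)
    exact ((measurable_id.mul this).mul h2).aestronglyMeasurable
  · filter_upwards [ae_restrict_mem measurableSet_Ioi] with r hr
    have hr' : 0 < r := hr
    have h1 := h.nonneg (u ^ 2 + r ^ 2) (by positivity)
    have h2 := ww_nonneg j t r
    rw [Real.norm_of_nonneg (by positivity), pow_succ' r j]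
    have := ww_le j ht hr'
    gcongr

lemma GG_diff (h : MuOK N μ C) {j : ℕ} (hm : j + 1 ≤ N) {u v : ℝ} (hu : 0 ≤ u) (huv : u ≤ v) :
    GG μ (j + 1) u - GG μ (j + 1) v =
      ∫ r in Set.Ioi (0 : ℝ), (r ^ (j + 1) - r * ww j (v ^ 2 - u ^ 2) r) * μ (u ^ 2 + r ^ 2) := by
  have hsq : 0 ≤ v ^ 2 - u ^ 2 := by nlinarith
  rw [GG_shift μ j hu huv, GG, ← integral_sub (h.int hm u) (h.wint hm u hsq)]
  congr 1; ext r; ring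

lemma diff_int (h : MuOK N μ C) {j : ℕ} (hm : j + 1 ≤ N) {u v : ℝ} (hu : 0 ≤ u) (huv : u ≤ v) :
    IntegrableOn (fun r => (r ^ (j + 1) - r * ww j (v ^ 2 - u ^ 2) r) * μ (u ^ 2 + r ^ 2)) (Set.Ioi 0) := by
  have hsq : 0 ≤ v ^ 2 - u ^ 2 := by nlinarith
  refine ((h.int hm u).sub (h.wint hm u hsq)).congr (Filter.Eventually.of_forall fun r => ?_)
  simp only [Pi.sub_apply]; ring

lemma diff_nn (h : MuOK N μ C) (j : ℕ) {u v : ℝ} (hu : 0 ≤ u) (huv : u ≤ v) (r : ℝ) (hr : 0 < r) :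
    0 ≤ (r ^ (j + 1) - r * ww j (v ^ 2 - u ^ 2) r) * μ (u ^ 2 + r ^ 2) := by
  have hsq : 0 ≤ v ^ 2 - u ^ 2 := by nlinarith
  refine mul_nonneg ?_ (h.nonneg _ (by positivity))
  have := mul_le_mul_of_nonneg_left (ww_le j hsq hr) hr.le
  rw [pow_succ']; linarith

lemma anti1 (h : MuOK N μ C) {j : ℕ} (hm : j + 1 ≤ N) {u v : ℝ} (hu : 0 ≤ u) (huv : u ≤ v) :
    GG μ (j + 1) v ≤ GG μ (j + 1) u := by
  have := h.GG_diff hm hu huv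
  have h2 := setIntegral_nonneg (μ := volume) measurableSet_Ioi (h.diff_nn j hu huv)
  linarith

lemma hol1 (h : MuOK N μ C) {j : ℕ} (hm : j + 1 ≤ N) {u v : ℝ} (hu : 0 ≤ u) (huv : u ≤ v) :
    GG μ (j + 1) u - GG μ (j + 1) v ≤ (j + 1) * (C * JJ) * √(v ^ 2 - u ^ 2) := by
  have hsq : 0 ≤ v ^ 2 - u ^ 2 := by nlinarith
  have hj : j ≤ N := by omega
  have h1 := h.GG_bd' hj u
  have h2 : GG μ (j + 1) u - GG μ (j + 1) v ≤ (j + 1) * √(v ^ 2 - u ^ 2) * GG μ j u := by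
    rw [h.GG_diff hm hu huv, GG, ← integral_const_mul]
    refine setIntegral_mono_on (h.diff_int hm hu huv) ((h.int hj u).const_mul _) measurableSet_Ioi fun r hr => ?_
    have := mul_le_mul_of_nonneg_right (ww_low j hsq hr) (h.nonneg (u ^ 2 + r ^ 2) (by positivity))
    linarith
  refine h2.trans ?_
  calc (j + 1) * √(v ^ 2 - u ^ 2) * GG μ j u ≤ (j + 1) * √(v ^ 2 - u ^ 2) * (C * JJ) := by gcongr
    _ = _ := by ring

lemma strict1 (h : MuOK N μ C) {j : ℕ} (hm : j + 1 ≤ N) {u v : ℝ} (hu : 0 ≤ u) (huv : u < v) {ε : ℝ} (hε : 0 < ε)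
    (hpos : ∀ r, 0 < r → r < ε → 0 < μ (u ^ 2 + r ^ 2)) :
    GG μ (j + 1) v < GG μ (j + 1) u := by
  have hsq : 0 < v ^ 2 - u ^ 2 := by nlinarith
  have h1 := h.GG_diff hm hu huv.le
  have h2 := pos_of (h.diff_int hm hu huv.le) (h.diff_nn j hu huv.le) le_rfl
    (lt_min hε (Real.sqrt_pos.2 hsq)) ?_
  · linarith
  · intro r hr hlt
    have h3 := hpos r hr (hlt.trans_le (min_le_left _ _))
    have h4 : r < √(v ^ 2 - u ^ 2) := hlt.trans_le (min_le_right _ _)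
    have h5 : r ^ 2 < v ^ 2 - u ^ 2 := (Real.lt_sqrt hr.le).1 h4
    unfold ww
    rw [if_neg (by linarith)]
    rw [mul_zero, sub_zero]
    positivity

lemma anti0 (h : MuOK N μ C) (ha : AntitoneOn μ (Set.Ici 0)) {u v : ℝ} (hu : 0 ≤ u) (huv : u ≤ v) :
    GG μ 0 v ≤ GG μ 0 u := by
  refine setIntegral_mono_on (h.int (Nat.zero_le _) v) (h.int (Nat.zero_le _) u) measurableSet_Ioi fun r hr => ?_
  simp only [pow_zero, one_mul]
  refine ha ?_ ?_ ?_
  · simp only [Set.mem_Ici]; positivity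
  · simp only [Set.mem_Ici]; positivity
  · gcongr

lemma hol0 (h : MuOK N μ C) (ha : AntitoneOn μ (Set.Ici 0)) {u v : ℝ} (hu : 0 ≤ u) (huv : u ≤ v) :
    GG μ 0 u - GG μ 0 v ≤ C * √(v ^ 2 - u ^ 2) := by
  have hsq : 0 ≤ v ^ 2 - u ^ 2 := by nlinarith
  set s := √(v ^ 2 - u ^ 2) with hs
  have hs0 : 0 ≤ s := Real.sqrt_nonneg _
  have hs2 : s ^ 2 = v ^ 2 - u ^ 2 := Real.sq_sqrt hsq
  have iu := h.int (Nat.zero_le N) u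
  simp only [pow_zero, one_mul] at iu
  have hsub : Set.Ioi s ⊆ Set.Ioi (0 : ℝ) := Set.Ioi_subset_Ioi hs0
  have e1 : GG μ 0 u = (∫ r in Set.Ioc 0 s, μ (u ^ 2 + r ^ 2)) + ∫ r in Set.Ioi s, μ (u ^ 2 + r ^ 2) := by
    rw [GG, ← setIntegral_union (Set.Ioc_disjoint_Ioi le_rfl) measurableSet_Ioi (iu.mono_set Set.Ioc_subset_Ioi_self) (iu.mono_set hsub),
      Set.Ioc_union_Ioi_eq_Ioi hs0]
    simp
  have e2 : ∫ r in Set.Ioi s, μ (u ^ 2 + r ^ 2) ≤ GG μ 0 v := by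
    have mp := measurePreserving_add_right (volume : Measure ℝ) s
    have me : MeasurableEmbedding (fun x : ℝ => x + s) := (MeasurableEquiv.addRight s).measurableEmbedding
    have hpre : (fun x : ℝ => x + s) ⁻¹' Set.Ioi s = Set.Ioi 0 := by simp
    have a1 := mp.setIntegral_preimage_emb me (fun r => μ (u ^ 2 + r ^ 2)) (Set.Ioi s)
    rw [hpre] at a1
    rw [← a1, GG]
    refine setIntegral_mono_on ?_ (h.int (Nat.zero_le _) v) measurableSet_Ioi fun r hr => ?_
    · have := (mp.integrableOn_comp_preimage me (f := fun r => μ (u ^ 2 + r ^ 2)) (s := Set.Ioi s)).2 (iu.mono_set hsub)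
      rw [hpre] at this
      exact this
    · simp only [Set.mem_Ioi] at hr
      simp only [pow_zero, one_mul]
      refine ha ?_ ?_ ?_
      · simp only [Set.mem_Ici]; positivity
      · simp only [Set.mem_Ici]; positivity
      · nlinarith [mul_nonneg hr.le hs0]
  have e3 : ∫ r in Set.Ioc 0 s, μ (u ^ 2 + r ^ 2) ≤ C * s := by
    have a1 : ∫ r in Set.Ioc 0 s, μ (u ^ 2 + r ^ 2) ≤ ∫ r in Set.Ioc 0 s, C := by
      refine setIntegral_mono_on (iu.mono_set Set.Ioc_subset_Ioi_self) (by simp) measurableSet_Ioc fun r hr => ?_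
      have := h.bd' (Nat.zero_le N) u hr.1
      simp only [pow_zero, one_mul] at this
      have h3 : (1 + r ^ 2)⁻¹ ≤ 1 := inv_le_one_of_one_le₀ (by nlinarith [sq_nonneg r])
      nlinarith [h.C0]
    refine a1.trans ?_
    simp [hs0, mul_comm]
  linarith

lemma strict0 (h : MuOK N μ C) (ha : AntitoneOn μ (Set.Ici 0)) {u v : ℝ} (hu : 0 ≤ u) (huv : u < v) {ε : ℝ} (hε : 0 < ε)
    (hpos : ∀ r, 0 < r → r < ε → 0 < μ (u ^ 2 + r ^ 2)) :
    GG μ 0 v < GG μ 0 u := by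
  have hc := h.cont
  have hsq : 0 < v ^ 2 - u ^ 2 := by nlinarith
  have hle : ∀ r, μ (v ^ 2 + r ^ 2) ≤ μ (u ^ 2 + r ^ 2) := by
    intro r
    refine ha ?_ ?_ ?_
    · simp only [Set.mem_Ici]; positivity
    · simp only [Set.mem_Ici]; positivity
    · nlinarith
  obtain ⟨r₀, hr₀, hlt⟩ : ∃ r, 0 < r ∧ μ (v ^ 2 + r ^ 2) < μ (u ^ 2 + r ^ 2) := by
    by_contra hcon
    push Not at hcon
    have heq : ∀ s, 0 < s → μ (u ^ 2 + s + (v ^ 2 - u ^ 2)) = μ (u ^ 2 + s) := by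
      intro s hs
      have a1 := hcon (√s) (Real.sqrt_pos.2 hs)
      have a2 := hle (√s)
      rw [Real.sq_sqrt hs.le] at a1 a2
      rw [show u ^ 2 + s + (v ^ 2 - u ^ 2) = v ^ 2 + s by ring]
      linarith
    set s := (ε / 2) ^ 2 with hs
    have hs0 : 0 < s := by positivity
    have hiter : ∀ i : ℕ, μ (u ^ 2 + (s + i * (v ^ 2 - u ^ 2))) = μ (u ^ 2 + s) := by
      intro i
      induction i with
      | zero => simp
      | succ i ih =>
        rw [← ih, ← heq (s + i * (v ^ 2 - u ^ 2)) (by positivity)]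
        congr 1; push_cast; ring
    have hp := hpos (ε / 2) (by linarith) (by linarith)
    rw [← hs] at hp
    obtain ⟨i, hi⟩ := exists_nat_gt (C / μ (u ^ 2 + s) / (v ^ 2 - u ^ 2))
    rw [div_lt_iff₀ hsq, div_lt_iff₀ hp] at hi
    set e := u ^ 2 + (s + i * (v ^ 2 - u ^ 2)) with he
    have he0 : 0 ≤ e := by positivity
    have h1 := h.dec e he0
    rw [hiter i] at h1
    have h2 : ((1 + e) ^ (N + 2))⁻¹ ≤ (1 + e)⁻¹ := by
      apply inv_anti₀ (by positivity)
      exact le_self_pow₀ (by linarith) (by omega)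
    have h3 : μ (u ^ 2 + s) ≤ C * (1 + e)⁻¹ := h1.trans (mul_le_mul_of_nonneg_left h2 h.C0)
    rw [← div_eq_mul_inv, le_div_iff₀ (by positivity)] at h3
    have h4 : i * (v ^ 2 - u ^ 2) ≤ 1 + e := by rw [he]; nlinarith [sq_nonneg u]
    nlinarith
  have h1 : GG μ 0 u - GG μ 0 v = ∫ r in Set.Ioi (0 : ℝ), (μ (u ^ 2 + r ^ 2) - μ (v ^ 2 + r ^ 2)) := by
    rw [GG, GG, ← integral_sub (h.int (Nat.zero_le _) u) (h.int (Nat.zero_le _) v)]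
    simp
  have hint : IntegrableOn (fun r => μ (u ^ 2 + r ^ 2) - μ (v ^ 2 + r ^ 2)) (Set.Ioi 0) := by
    have := (h.int (Nat.zero_le N) u).sub (h.int (Nat.zero_le N) v)
    refine this.congr (Filter.Eventually.of_forall fun r => by simp)
  have hcont : Continuous (fun r => μ (u ^ 2 + r ^ 2) - μ (v ^ 2 + r ^ 2)) := by fun_prop
  have hopen : IsOpen {r | 0 < μ (u ^ 2 + r ^ 2) - μ (v ^ 2 + r ^ 2)} := isOpen_lt continuous_const hcont
  obtain ⟨τ, hτ, hball⟩ := Metric.isOpen_iff.1 hopen r₀ (by simp only [Set.mem_ofPred_eq]; linarith)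
  have h2 := pos_of hint (fun r _ => by linarith [hle r]) hr₀.le (show r₀ < r₀ + τ by linarith) (fun r h1 h2 => by
    apply hball
    rw [Metric.mem_ball, Real.dist_eq, abs_lt]
    constructor <;> linarith)
  linarith

lemma phi_eq (μ : ℝ → ℝ) (m : ℕ) : ∃ c, 0 < c ∧ ∀ u, phiMarg (m + 2) μ u = c * GG μ m u := by
  refine ⟨(m + 1 : ℕ) * (volume : Measure (EuclideanSpace ℝ (Fin (m + 1)))).real (Metric.ball 0 1), ?_, ?_⟩
  · have : 0 < (volume : Measure (EuclideanSpace ℝ (Fin (m + 1)))).real (Metric.ball 0 1) :=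
      ENNReal.toReal_pos (Metric.measure_ball_pos _ _ one_pos).ne' measure_ball_lt_top.ne
    positivity
  · intro u
    have := integral_fun_norm_addHaar (volume : Measure (EuclideanSpace ℝ (Fin (m + 1)))) (fun r => μ (u ^ 2 + r ^ 2))
    unfold phiMarg GG
    simp only [finrank_euclideanSpace, Fintype.card_fin, Nat.add_sub_cancel, smul_eq_mul, nsmul_eq_mul] at this
    refine Eq.trans this ?_
    ring

lemma full_int (m : ℕ) (h : MuOK (m + 1) μ C) : Integrable (fun p : EuclideanSpace ℝ (Fin (m + 2)) => μ (‖p‖ ^ 2)) := by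
  have := integrable_fun_norm_addHaar (volume : Measure (EuclideanSpace ℝ (Fin (m + 2)))) (f := fun r => μ (r ^ 2))
  refine this.2 ?_
  have h2 := h.int le_rfl 0
  simpa using h2

lemma phiOK (m : ℕ) (h : MuOK (m + 1) μ C) (ha : m = 0 → AntitoneOn μ (Set.Ici 0)) :
    ∃ C', PhiOK (phiMarg (m + 2) μ) C' := by
  obtain ⟨c, hc, hφ⟩ := phi_eq μ m
  have hJ := JJ_nonneg
  have hC := h.C0
  have hmm : m ≤ m + 1 := Nat.le_succ m
  refine ⟨c * (C * JJ * (m + 1) + C), ?_, ?_, ?_, ?_, ?_, ?_⟩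
  · have := h.GG_cont hmm
    have e : phiMarg (m + 2) μ = fun u => c * GG μ m u := funext hφ
    rw [e]; fun_prop
  · intro u; simp [phiMarg]
  · intro u
    rw [hφ]
    have := h.GG_nonneg m u
    positivity
  · intro u
    rw [hφ, mul_assoc]
    refine mul_le_mul_of_nonneg_left ((h.GG_bd hmm u).trans ?_) hc.le
    gcongr
    have : 0 ≤ C * JJ * m := by positivity
    linarith
  · intro u v hu huv
    rw [hφ, hφ]
    refine mul_le_mul_of_nonneg_left ?_ hc.le
    rcases m with _ | j
    · exact h.anti0 (ha rfl) hu huv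
    · exact h.anti1 hmm hu huv
  · intro u v hu huv
    rw [hφ, hφ, ← mul_sub, mul_assoc]
    refine mul_le_mul_of_nonneg_left ?_ hc.le
    rcases m with _ | j
    · refine (h.hol0 (ha rfl) hu huv).trans ?_
      gcongr
      have : 0 ≤ C * JJ := by positivity
      simp; linarith
    · refine (h.hol1 hmm hu huv).trans ?_
      gcongr
      have : 0 ≤ C * JJ := by positivity
      push_cast
      nlinarith

lemma phi_strict (m : ℕ) (h : MuOK (m + 1) μ C) (ha : m = 0 → AntitoneOn μ (Set.Ici 0))
    {u v : ℝ} (hu : 0 ≤ u) (huv : u < v) {ε : ℝ} (hε : 0 < ε)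
    (hpos : ∀ r, 0 < r → r < ε → 0 < μ (u ^ 2 + r ^ 2)) : phiMarg (m + 2) μ v < phiMarg (m + 2) μ u := by
  obtain ⟨c, hc, hφ⟩ := phi_eq μ m
  rw [hφ, hφ]
  refine mul_lt_mul_of_pos_left ?_ hc
  rcases m with _ | j
  · exact h.strict0 (ha rfl) hu huv hε hpos
  · exact h.strict1 (Nat.le_succ _) hu huv hε hpos

end MuOK

lemma speed_pos (m : ℕ) (μ : ℝ → ℝ) (hppos : ∀ p : EuclideanSpace ℝ (Fin (m + 2)),
      ENNReal.ofReal ‖p‖ < maxSpeed (m + 2) μ → 0 < μ (‖p‖ ^ 2)) {r : ℝ} (hr : 0 ≤ r)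
    (h : ENNReal.ofReal r < maxSpeed (m + 2) μ) : 0 < μ (r ^ 2) := by
  have hn : ‖(EuclideanSpace.single 0 r : EuclideanSpace ℝ (Fin (m + 2)))‖ = r := by
    simp [abs_of_nonneg hr]
  have := hppos (EuclideanSpace.single 0 r)
  rw [hn] at this
  exact this h

lemma speed_zero (m : ℕ) (μ : ℝ → ℝ) (hc : Continuous μ) (hS : maxSpeed (m + 2) μ ≠ ⊤) {r : ℝ}
    (hr : (maxSpeed (m + 2) μ).toReal ≤ r) : μ (r ^ 2) = 0 := by
  have h1 : Set.EqOn (fun r => μ (r ^ 2)) (fun _ => 0) (Set.Ioi (maxSpeed (m + 2) μ).toReal) := by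
    intro r hr
    by_contra hne
    have hr0 : 0 ≤ r := ENNReal.toReal_nonneg.trans (le_of_lt hr)
    have hn : ‖(EuclideanSpace.single 0 r : EuclideanSpace ℝ (Fin (m + 2)))‖ = r := by
      simp [abs_of_nonneg hr0]
    have h2 : ENNReal.ofReal r ≤ maxSpeed (m + 2) μ := by
      have := le_iSup₂ (f := fun (p : EuclideanSpace ℝ (Fin (m + 2))) (_ : μ (‖p‖ ^ 2) ≠ 0) => ENNReal.ofReal ‖p‖)
        (EuclideanSpace.single 0 r) (by rw [hn]; exact hne)
      rw [hn] at this
      exact this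
    have h3 := (ENNReal.ofReal_le_iff_le_toReal hS).1 h2
    exact absurd hr (not_lt.2 h3)
  have h2 := h1.closure (by fun_prop) continuous_const
  rw [closure_Ioi] at h2
  exact h2 hr

lemma mu_ok (m : ℕ) (μ : ℝ → ℝ) (n₀ : ℕ) (hμ0 : ∀ e : ℝ, 0 ≤ e → 0 ≤ μ e)
    (hn₀ : (((m + 2 : ℕ) : ℝ) + 15) / 2 ≤ (n₀ : ℝ)) (hc : Continuous μ)
    (hdecay_inf : maxSpeed (m + 2) μ = ⊤ → ∃ C n₁ : ℝ,
      (n₀ : ℝ) + (((m + 2 : ℕ) : ℝ) + 1) / 2 ≤ n₁ ∧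
      ∀ e : ℝ, 0 ≤ e → |μ e| ≤ C * (1 + e) ^ (-n₁)) : ∃ C, MuOK (m + 1) μ C := by
  by_cases hS : maxSpeed (m + 2) μ = ⊤
  · obtain ⟨C, n₁, hn, hb⟩ := hdecay_inf hS
    have hC : 0 ≤ C := by
      have := hb 0 le_rfl
      simp at this
      exact (abs_nonneg _).trans this
    refine ⟨C, hc, hμ0, hC, fun e he => ?_⟩
    refine (le_abs_self _).trans ((hb e he).trans ?_)
    refine mul_le_mul_of_nonneg_left ?_ hC
    rw [← Real.rpow_natCast, ← Real.rpow_neg (by linarith)]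
    apply Real.rpow_le_rpow_of_exponent_le (by linarith)
    push_cast at hn hn₀ ⊢
    have : (0 : ℝ) ≤ m := Nat.cast_nonneg m
    linarith
  · set Υ := (maxSpeed (m + 2) μ).toReal with hΥ
    obtain ⟨B, hB⟩ := (isCompact_Icc (a := (0 : ℝ)) (b := Υ ^ 2)).exists_bound_of_continuousOn hc.continuousOn
    have hB0 : 0 ≤ B := (norm_nonneg _).trans (hB 0 ⟨le_rfl, by positivity⟩)
    refine ⟨B * (1 + Υ ^ 2) ^ (m + 1 + 2), hc, hμ0, by positivity, fun e he => ?_⟩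
    by_cases hle : e ≤ Υ ^ 2
    · refine ((le_abs_self _).trans (hB e ⟨he, hle⟩)).trans ?_
      rw [← div_eq_mul_inv, le_div_iff₀ (by positivity)]
      gcongr
    · have h1 : Υ ≤ √e := Real.le_sqrt_of_sq_le (not_le.1 hle).le
      have h2 := speed_zero m μ hc hS h1
      rw [Real.sq_sqrt he] at h2
      rw [h2]; positivity

theorem stmt15 (d : ℕ) (hd : 2 ≤ d) (μ : ℝ → ℝ) (n₀ : ℕ)
    (hμ0 : ∀ e : ℝ, 0 ≤ e → 0 ≤ μ e)
    (hn₀ : ((d : ℝ) + 15) / 2 ≤ (n₀ : ℝ))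
    (hreg : ContDiff ℝ n₀ μ)
    (hppos : ∀ p : EuclideanSpace ℝ (Fin d),
      ENNReal.ofReal ‖p‖ < maxSpeed d μ → 0 < μ (‖p‖ ^ 2))
    (hdecay_inf : maxSpeed d μ = ⊤ → ∃ C n₁ : ℝ,
      (n₀ : ℝ) + ((d : ℝ) + 1) / 2 ≤ n₁ ∧
      ∀ e : ℝ, 0 ≤ e → |μ e| ≤ C * (1 + e) ^ (-n₁))
    (hdecay_fin : maxSpeed d μ ≠ ⊤ → ∃ n₁ : ℝ,
      min 1 ((5 - (d : ℝ)) / 2) ≤ n₁ ∧ ∃ L : ℝ, 0 < L ∧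
      Filter.Tendsto
        (fun r : ℝ => μ (r ^ 2) / ((maxSpeed d μ).toReal - r) ^ n₁)
        (nhdsWithin (maxSpeed d μ).toReal (Set.Iio (maxSpeed d μ).toReal))
        (nhds L))
    (hd2 : d = 2 → ∀ e : ℝ, 0 ≤ e → deriv μ e ≤ 0)
    (κ₀ : ℝ)
    (hκ₀_inf : maxSpeed d μ = ⊤ → κ₀ = 0)
    (hκ₀_fin : maxSpeed d μ ≠ ⊤ → 0 < κ₀ ∧
      κ₀ ^ 2 = (1 / 2) *
        ∫ u in Set.Ioo (-(maxSpeed d μ).toReal) (maxSpeed d μ).toReal,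
          phiMarg d μ u /
            (((maxSpeed d μ).toReal - u) * ((maxSpeed d μ).toReal + κ₀ - u))) :
    ∀ δ : ℝ, 0 < δ → ∃ c : ℝ, 0 < c ∧
      ∀ k : EuclideanSpace ℝ (Fin d), κ₀ + δ ≤ ‖k‖ →
        ∀ lam : ℂ, 0 < lam.re → c ≤ ‖Dlin d μ lam k‖ := by
  obtain ⟨m, rfl⟩ := Nat.exists_eq_add_of_le' hd
  intro δ hδ
  have hc := hreg.continuous
  obtain ⟨C, hM⟩ := mu_ok m μ n₀ hμ0 hn₀ hc hdecay_inf
  have hn0 : (n₀ : WithTop ℕ∞) ≠ 0 := by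
    intro h0
    have h1 : n₀ = 0 := by exact_mod_cast h0
    rw [h1] at hn₀
    push_cast at hn₀
    have : (0 : ℝ) ≤ m := Nat.cast_nonneg m
    linarith
  have ha : m = 0 → AntitoneOn μ (Set.Ici 0) := by
    intro hm
    refine antitoneOn_of_deriv_nonpos (convex_Ici 0) hc.continuousOn (hreg.differentiable hn0).differentiableOn ?_
    intro x hx
    rw [interior_Ici] at hx
    exact hd2 (by omega) x (le_of_lt hx)
  obtain ⟨C', hP⟩ := hM.phiOK m ha
  have hκ₀ : 0 ≤ κ₀ := by
    by_cases hS : maxSpeed (m + 2) μ = ⊤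
    · rw [hκ₀_inf hS]
    · exact (hκ₀_fin hS).1.le
  obtain ⟨c, hc0, hcl⟩ := hP.lower hκ₀ hδ (by
    intro u v hu huv
    by_cases hlt : ENNReal.ofReal u < maxSpeed (m + 2) μ
    · left
      obtain ⟨ε, hε, hpos⟩ : ∃ ε, 0 < ε ∧ ∀ r, 0 < r → r < ε → 0 < μ (u ^ 2 + r ^ 2) := by
        have h0 := speed_pos m μ hppos hu hlt
        have hopen : IsOpen {r | 0 < μ (u ^ 2 + r ^ 2)} := isOpen_lt continuous_const (by fun_prop)
        obtain ⟨ε, hε, hb⟩ := Metric.isOpen_iff.1 hopen 0 (by simpa using h0)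
        refine ⟨ε, hε, fun r h1 h2 => ?_⟩
        apply hb
        simpa [abs_of_pos h1] using h2
      exact hM.phi_strict m ha hu huv hε hpos
    · right
      have hS : maxSpeed (m + 2) μ ≠ ⊤ := by
        intro h; rw [h] at hlt; exact hlt ENNReal.ofReal_lt_top
      obtain ⟨hk0, hk⟩ := hκ₀_fin hS
      have hu' : (maxSpeed (m + 2) μ).toReal ≤ u := ENNReal.toReal_le_of_le_ofReal hu (not_lt.1 hlt)
      have hz : ∀ r, (maxSpeed (m + 2) μ).toReal ≤ r → μ (r ^ 2) = 0 := fun r hr => speed_zero m μ hc hS hr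
      have hΥ0 : 0 ≤ (maxSpeed (m + 2) μ).toReal := ENNReal.toReal_nonneg
      clear hdecay_fin hdecay_inf
      generalize (maxSpeed (m + 2) μ).toReal = Υ at *
      have hk2 : κ₀ ^ 2 ≠ 0 := by positivity
      refine ⟨Υ, ?_, hu', ?_, ?_, ?_⟩
      · refine lt_of_le_of_ne hΥ0 fun h => hk2 ?_
        rw [hk, ← h]; simp
      · intro w hw
        unfold phiMarg
        refine integral_eq_zero_of_ae (Filter.Eventually.of_forall fun x => ?_)
        simp only [Pi.zero_apply]
        have h1 := hz (√(w ^ 2 + ‖x‖ ^ 2)) (Real.le_sqrt_of_sq_le (by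
          have : Υ ^ 2 ≤ |w| ^ 2 := by gcongr
          rw [sq_abs] at this
          nlinarith [sq_nonneg ‖x‖]))
        rwa [Real.sq_sqrt (by positivity)] at h1
      · by_contra hni
        apply hk2
        rw [hk, integral_undef hni, mul_zero]
      · linarith)
  refine ⟨√c, Real.sqrt_pos.2 hc0, fun k hk lam hlam => ?_⟩
  have hk0 : 0 < ‖k‖ := by linarith
  have h1 := Dlin_eq (m + 1) μ hP (hM.full_int m) k hk0 lam hlam
  have h2 := hcl ‖k‖ (lam.im / (2 * ‖k‖)) (lam.re / (2 * ‖k‖)) hk (by positivity)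
  rw [Real.sqrt_le_left (norm_nonneg _)]
  exact h2.trans h1.ge
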